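/- Let α ≥ 0, let B be the open unit disc of ℝ², let β > 0 satisfy z_1(β) = z_2(0), and set k = ⌈(2+α)β/2 − 1⌉, where ⌈s⌉ denotes the least integer ≥ s. Then there exists p̄ = p̄(α) > 1 such that for every p ∈ (1, p̄) there exist k classical solutions u_1, …, u_k of the Hénon problem with exponent p, each sign-changing and not radial, which are pairwise distinct modulo rotations and sign: for all i ≠ j, for every rotation R of ℝ² about the origin and every ε ∈ {−1, +1}, u_i ≠ ε · (u_j ∘ R). -/

import Mathlib

open Real MeasureTheory Metric Filter Topology

noncomputable section

/-- The Euclidean plane. -/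
abbrev E2 := EuclideanSpace ℝ (Fin 2)

/-- The Laplacian of `u : ℝ² → ℝ`. -/
def lap (u : E2 → ℝ) (x : E2) : ℝ :=
  ∑ i : Fin 2, fderiv ℝ (fun y => fderiv ℝ u y (EuclideanSpace.single i 1)) x
    (EuclideanSpace.single i 1)

/-- A classical solution of the planar Hénon problem with parameter `α` and exponent `p`. -/
def IsHenonSol (α p : ℝ) (u : E2 → ℝ) : Prop :=
  ContDiffOn ℝ 2 u (ball 0 1) ∧ ContinuousOn u (closedBall 0 1) ∧
  (∀ x ∈ ball (0 : E2) 1, -lap u x = ‖x‖ ^ α * |u x| ^ (p - 1) * u x) ∧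
  (∀ x : E2, ‖x‖ = 1 → u x = 0)

/-- Rotation of the plane by the angle `θ` about the origin. -/
def rot2 (θ : ℝ) (q : E2) : E2 :=
  (EuclideanSpace.equiv (Fin 2) ℝ).symm
    ![Real.cos θ * q 0 - Real.sin θ * q 1, Real.sin θ * q 0 + Real.cos θ * q 1]

/-- The Bessel function of the first kind of order `β`. -/
def besselJ (β r : ℝ) : ℝ :=
  r ^ β * ∑' k : ℕ,
    ((-1 : ℝ) ^ k / (Nat.factorial k * Real.Gamma ((k : ℝ) + 1 + β))) * (r / 2) ^ (2 * k)

/-- `z` is the `i`-th positive zero of `J_β`. -/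
def IsNthZero (β : ℝ) (i : ℕ) (z : ℝ) : Prop :=
  0 < z ∧ besselJ β z = 0 ∧ {r ∈ Set.Ioo 0 z | besselJ β r = 0}.encard = ((i - 1 : ℕ) : ℕ∞)

open scoped ComplexConjugate

/-- The signed power nonlinearity `x ↦ |x|^{p-1} x`. -/
def signedPow (p x : ℝ) : ℝ := |x| ^ (p - 1) * x

lemma continuous_signedPow {p : ℝ} (hp : 1 < p) : Continuous (signedPow p) :=
  (continuous_abs.rpow_const fun _ => Or.inr (by linarith)).mul continuous_id

lemma abs_signedPow {p : ℝ} (hp : 1 < p) (x : ℝ) : |signedPow p x| = |x| ^ p := by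
  rcases eq_or_ne x 0 with rfl | hx
  · simp [signedPow, Real.zero_rpow (by linarith : p ≠ 0)]
  · rw [signedPow, abs_mul, abs_of_nonneg (Real.rpow_nonneg (abs_nonneg x) _),
      ← Real.rpow_add_one (abs_ne_zero.mpr hx)]
    congr 1; ring

lemma signedPow_mul_self {p : ℝ} (hp : 1 < p) (x : ℝ) :
    signedPow p x * x = |x| ^ (p + 1) := by
  rcases eq_or_ne x 0 with rfl | hx
  · simp [signedPow, Real.zero_rpow (by linarith : p + 1 ≠ 0)]
  · rw [signedPow, mul_assoc, ← abs_mul_abs_self x, ← mul_assoc,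
      ← Real.rpow_add_one (abs_ne_zero.mpr hx), ← Real.rpow_add_one (abs_ne_zero.mpr hx)]
    congr 1; ring

lemma signedPow_mul {p c : ℝ} (hp : 1 < p) (hc : 0 ≤ c) (x : ℝ) :
    signedPow p (c * x) = c ^ p * signedPow p x := by
  rcases hc.eq_or_lt with rfl | hc
  · simp [signedPow, Real.zero_rpow (by linarith : p ≠ 0)]
  · have : c ^ p = c ^ (p - 1) * c := by
      rw [← Real.rpow_add_one hc.ne']; congr 1; ring
    rw [signedPow, signedPow, abs_mul, abs_of_pos hc, Real.mul_rpow hc.le (abs_nonneg x), this]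
    ring

lemma signedPow_neg (p x : ℝ) : signedPow p (-x) = -signedPow p x := by
  simp [signedPow]

lemma signedPow_mul_le {p : ℝ} (hp : 1 < p) (x y : ℝ) :
    (p + 1) * (signedPow p x * y) ≤ p * |x| ^ (p + 1) + |y| ^ (p + 1) := by
  have hpq : Real.HolderConjugate ((p + 1) / p) (p + 1) := by
    rw [Real.holderConjugate_iff]
    constructor
    · rw [lt_div_iff₀ (by linarith)]; linarith
    · field_simp
  have h := Real.young_inequality (signedPow p x) y hpq
  have h2 : |signedPow p x| ^ ((p + 1) / p) = |x| ^ (p + 1) := by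
    rw [abs_signedPow hp, ← Real.rpow_mul (abs_nonneg x)]
    congr 1; field_simp
  rw [h2] at h
  have h3 := mul_le_mul_of_nonneg_left h (by linarith : 0 ≤ p + 1)
  refine h3.trans_eq ?_
  have : p ≠ 0 := by linarith
  have : p + 1 ≠ 0 := by linarith
  field_simp

lemma nonpos_of_forall_mul_le {a K : ℝ} (h : ∀ t : ℝ, 0 < t → t * a ≤ K) : a ≤ 0 := by
  by_contra! ha
  have := h ((|K| + 1) / a) (by positivity)
  rw [div_mul_cancel₀ _ ha.ne'] at this
  linarith [le_abs_self K]

section Variational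

variable {X : Type*} [TopologicalSpace X]

/-- The superposition operator of `signedPow p`. -/
def powMap (p : ℝ) (hp : 1 < p) (u : C(X, ℝ)) : C(X, ℝ) :=
  ContinuousMap.comp ⟨signedPow p, continuous_signedPow hp⟩ u

/-- The function `|u|^{p+1}`. -/
def powAbs (p : ℝ) (hp : 1 < p) (u : C(X, ℝ)) : C(X, ℝ) :=
  ContinuousMap.comp ⟨fun x => |x| ^ (p + 1),
    continuous_abs.rpow_const fun _ => Or.inr (by linarith)⟩ u

@[simp] lemma powMap_apply (p : ℝ) (hp : 1 < p) (u : C(X, ℝ)) (x : X) :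
    powMap p hp u x = signedPow p (u x) := rfl

@[simp] lemma powAbs_apply (p : ℝ) (hp : 1 < p) (u : C(X, ℝ)) (x : X) :
    powAbs p hp u x = |u x| ^ (p + 1) := rfl

lemma continuous_powMap (p : ℝ) (hp : 1 < p) : Continuous (powMap (X := X) p hp) :=
  ContinuousMap.continuous_postcomp _

lemma continuous_powAbs (p : ℝ) (hp : 1 < p) : Continuous (powAbs (X := X) p hp) :=
  ContinuousMap.continuous_postcomp _

lemma powMap_mul_self (p : ℝ) (hp : 1 < p) (u : C(X, ℝ)) :
    powMap p hp u * u = powAbs p hp u := by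
  ext x; exact signedPow_mul_self hp _

lemma powMap_smul {p c : ℝ} (hp : 1 < p) (hc : 0 ≤ c) (u : C(X, ℝ)) :
    powMap p hp (c • u) = c ^ p • powMap p hp u := by
  ext x; exact signedPow_mul hp hc _

lemma powAbs_smul {p c : ℝ} (hp : 1 < p) (hc : 0 ≤ c) (u : C(X, ℝ)) :
    powAbs p hp (c • u) = c ^ (p + 1) • powAbs p hp u := by
  ext x
  simp [abs_mul, abs_of_nonneg hc, Real.mul_rpow hc (abs_nonneg _)]

variable {p : ℝ} {hp : 1 < p} {L : C(X, ℝ) →L[ℝ] ℝ} {T : C(X, ℝ) →L[ℝ] C(X, ℝ)}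

lemma young_functional (hL : ∀ a, 0 ≤ a → 0 ≤ L a) (u v : C(X, ℝ)) :
    (p + 1) * L (powMap p hp u * v) ≤ p * L (powAbs p hp u) + L (powAbs p hp v) := by
  have h := hL (p • powAbs p hp u + powAbs p hp v - (p + 1) • (powMap p hp u * v)) (by
    intro x
    simpa using signedPow_mul_le hp (u x) (v x))
  simp only [map_sub, map_add, map_smul, smul_eq_mul] at h
  linarith

lemma functional_powAbs_nonneg (hL : ∀ a, 0 ≤ a → 0 ≤ L a) (u : C(X, ℝ)) :
    0 ≤ L (powAbs p hp u) :=
  hL _ fun _ => Real.rpow_nonneg (abs_nonneg _) _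

lemma functional_powAbs_pos (hL : ∀ a, 0 ≤ a → 0 ≤ L a) {u v : C(X, ℝ)}
    (h : 0 < L (powMap p hp u * v)) : 0 < L (powAbs p hp u) ∧ 0 < L (powAbs p hp v) := by
  constructor
  · refine (functional_powAbs_nonneg hL u).lt_of_ne' fun h0 => ?_
    refine absurd (nonpos_of_forall_mul_le (K := L (powAbs p hp v)) fun t ht => ?_) h.not_ge
    have hy := young_functional (hp := hp) hL ((t / (p + 1)) ^ (p⁻¹) • u) v
    have hq : 0 ≤ t / (p + 1) := by have : 0 < p + 1 := by linarith
                                    positivity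
    rw [powMap_smul hp (Real.rpow_nonneg hq _), powAbs_smul hp (Real.rpow_nonneg hq _),
      Real.rpow_inv_rpow hq (by linarith), map_smul, h0, smul_mul_assoc, map_smul] at hy
    simp only [smul_eq_mul, mul_zero, zero_add, ← mul_assoc] at hy
    rwa [mul_div_cancel₀ _ (by linarith : p + 1 ≠ 0)] at hy
  · refine (functional_powAbs_nonneg hL v).lt_of_ne' fun h0 => ?_
    refine absurd (nonpos_of_forall_mul_le (K := p * L (powAbs p hp u)) fun t ht => ?_) h.not_ge
    have hq : 0 ≤ t / (p + 1) := by have : 0 < p + 1 := by linarith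
                                    positivity
    have hy := young_functional (hp := hp) hL u ((t / (p + 1)) • v)
    rw [powAbs_smul hp hq, map_smul, h0, mul_smul_comm, map_smul] at hy
    simp only [smul_eq_mul, mul_zero, add_zero, ← mul_assoc] at hy
    rwa [mul_div_cancel₀ _ (by linarith : p + 1 ≠ 0)] at hy

lemma exists_normalized {u : C(X, ℝ)} (h : 0 < L (powAbs p hp u)) :
    ∃ c : ℝ, 0 < c ∧ L (powAbs p hp (c • u)) = 1 := by
  refine ⟨(L (powAbs p hp u)) ^ (-(p + 1)⁻¹), Real.rpow_pos_of_pos h _, ?_⟩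
  rw [powAbs_smul hp (Real.rpow_pos_of_pos h _).le, map_smul, smul_eq_mul, ← Real.rpow_mul h.le,
    neg_mul, inv_mul_cancel₀ (by linarith), Real.rpow_neg_one, inv_mul_cancel₀ h.ne']

lemma exists_ascent_step (hL : ∀ a, 0 ≤ a → 0 ≤ L a)
    (hsymm : ∀ a b, L (a * T b) = L (b * T a))
    {u : C(X, ℝ)} (hu : L (powAbs p hp u) = 1)
    (hN : 0 < L (powMap p hp u * T (powMap p hp u))) :
    ∃ (r : ℝ) (w : C(X, ℝ)), L (powMap p hp u * T (powMap p hp u)) ≤ r ∧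
      L (powAbs p hp w) = 1 ∧ T (powMap p hp u) = r • w ∧
      L ((powMap p hp w - powMap p hp u) * T (powMap p hp w - powMap p hp u)) =
        L (powMap p hp w * T (powMap p hp w)) + L (powMap p hp u * T (powMap p hp u)) - 2 * r := by
  obtain ⟨c, hc, h1⟩ := exists_normalized (functional_powAbs_pos hL hN).2
  set v := T (powMap p hp u) with hv
  have hvw : v = c⁻¹ • (c • v) := by rw [smul_smul, inv_mul_cancel₀ hc.ne', one_smul]
  refine ⟨c⁻¹, c • v, ?_, h1, hvw, ?_⟩
  · have hy := young_functional (hp := hp) hL u (c • v)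
    rw [hu, h1, mul_smul_comm, map_smul, smul_eq_mul] at hy
    rw [← one_div, le_div_iff₀ hc]
    nlinarith
  · have h2 : L (powMap p hp (c • v) * T (powMap p hp u)) = c⁻¹ := by
      rw [← hv]
      have : powMap p hp (c • v) * v = c⁻¹ • (powMap p hp (c • v) * (c • v)) := by
        rw [← mul_smul_comm, ← hvw]
      rw [this, powMap_mul_self, map_smul, h1, smul_eq_mul, mul_one]
    have h3 := hsymm (powMap p hp u) (powMap p hp (c • v))
    rw [h2] at h3
    rw [map_sub T, sub_mul, mul_sub, mul_sub, map_sub, map_sub, map_sub, h2, h3]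
    ring

/-- A compact positive symmetric operator `T` has a nonlinear eigenfunction
`T (|u|^{p-1} u) = r u`. -/
theorem exists_nonlinear_eigenfunction [CompactSpace X] (hL : ∀ a, 0 ≤ a → 0 ≤ L a)
    (hsymm : ∀ a b, L (a * T b) = L (b * T a)) (hpos : ∀ a, 0 ≤ L (a * T a))
    (hdef : ∀ a, L (a * T a) = 0 → T a = 0) (hcpt : IsCompactOperator T)
    (hbdd : ∃ C, ∀ u, L (powAbs p hp u) = 1 → ‖T (powMap p hp u)‖ ≤ C)
    (hnt : ∃ u, 0 < L (powMap p hp u * T (powMap p hp u))) :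
    ∃ (r : ℝ) (u : C(X, ℝ)), 0 < r ∧ u ≠ 0 ∧ T (powMap p hp u) = r • u := by
  obtain ⟨C, hC⟩ := hbdd
  obtain ⟨u₀, hu₀⟩ := hnt
  set N : C(X, ℝ) → ℝ := fun u => L (powMap p hp u * T (powMap p hp u)) with hNdef
  have hNcont : Continuous N :=
    L.continuous.comp ((continuous_powMap p hp).mul (T.continuous.comp (continuous_powMap p hp)))
  obtain ⟨c, hc, hc1⟩ := exists_normalized (functional_powAbs_pos hL hu₀).1
  set δ := N (c • u₀) with hδ
  have hδpos : 0 < δ := by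
    have : δ = c ^ p * (c ^ p * N u₀) := by
      simp only [hδ, hNdef, powMap_smul hp hc.le, map_smul, smul_mul_assoc, mul_smul_comm,
        smul_eq_mul]
    rw [this]; positivity
  have step : ∀ u, L (powAbs p hp u) = 1 → δ ≤ N u → ∃ (r : ℝ) (w : C(X, ℝ)), N u ≤ r ∧
      L (powAbs p hp w) = 1 ∧ T (powMap p hp u) = r • w ∧ N u ≤ N w ∧ ‖w‖ ≤ C / δ := by
    intro u hu hNu
    obtain ⟨r, w, h1, h2, h3, h4⟩ := exists_ascent_step hL hsymm hu (hδpos.trans_le hNu)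
    refine ⟨r, w, h1, h2, h3, ?_, ?_⟩
    · have := hpos (powMap p hp w - powMap p hp u)
      change 0 ≤ _ at this
      rw [h4] at this
      simp only [hNdef] at h1 ⊢
      linarith
    · have h5 := hC u hu
      have h6 : δ ≤ r := hNu.trans h1
      rw [h3, norm_smul, Real.norm_of_nonneg (hδpos.le.trans h6)] at h5
      rw [le_div_iff₀ hδpos]
      nlinarith [norm_nonneg w]
  -- the set of functions reached by two steps is relatively compact
  obtain ⟨K₁, hK₁, hK₁'⟩ := (isCompactOperator_iff_image_closedBall_subset_compact
    (𝕜₁ := ℝ) (T : C(X, ℝ) →ₗ[ℝ] C(X, ℝ)) (one_pos)).1 hcpt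
  set R := (|C / δ| + 1) ^ p with hR
  set K : Set C(X, ℝ) := (fun q : ℝ × C(X, ℝ) => q.1 • q.2) '' (Set.Icc 0 (δ⁻¹ * R) ×ˢ K₁) with hK
  have hKc : IsCompact K := (isCompact_Icc.prod hK₁).image continuous_smul
  have two : ∀ u, L (powAbs p hp u) = 1 → δ ≤ N u →
      ∃ w ∈ K, L (powAbs p hp w) = 1 ∧ N u ≤ N w := by
    intro u hu hNu
    obtain ⟨r, w, -, h2, -, h4, h5⟩ := step u hu hNu
    obtain ⟨r', w', h1', h2', h3', h4', -⟩ := step w h2 (hNu.trans h4)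
    refine ⟨w', ?_, h2', h4.trans h4'⟩
    have hr' : δ ≤ r' := (hNu.trans h4).trans h1'
    have hr'pos : 0 < r' := hδpos.trans_le hr'
    have hRpos : 0 < R := by positivity
    have hnorm : ‖powMap p hp w‖ ≤ R := by
      rw [ContinuousMap.norm_le _ hRpos.le]
      intro x
      rw [powMap_apply, Real.norm_eq_abs, abs_signedPow hp]
      refine Real.rpow_le_rpow (abs_nonneg _) ?_ (by linarith)
      have := w.norm_coe_le_norm x
      rw [Real.norm_eq_abs] at this
      linarith [le_abs_self (C / δ)]
    refine ⟨(r'⁻¹ * R, T (R⁻¹ • powMap p hp w)), ⟨⟨by positivity, ?_⟩, ?_⟩, ?_⟩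
    · exact mul_le_mul_of_nonneg_right (inv_anti₀ hδpos hr') hRpos.le
    · apply hK₁'
      refine ⟨_, ?_, rfl⟩
      rw [mem_closedBall_zero_iff, norm_smul, norm_inv, Real.norm_of_nonneg hRpos.le,
        inv_mul_le_iff₀ hRpos, mul_one]
      exact hnorm
    · simp only [map_smul, h3', smul_smul]
      rw [mul_assoc, mul_inv_cancel_left₀ hRpos.ne', inv_mul_cancel₀ hr'pos.ne', one_smul]
  have hclosed : IsClosed {u : C(X, ℝ) | L (powAbs p hp u) = 1 ∧ δ ≤ N u} :=
    (isClosed_eq (L.continuous.comp (continuous_powAbs p hp)) continuous_const).inter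
      (isClosed_le continuous_const hNcont)
  obtain ⟨w₀, hw₀K, hw₀1, hw₀2⟩ := two _ hc1 le_rfl
  obtain ⟨u, ⟨huK, hu1, hu2⟩, humax⟩ := (hKc.inter_right hclosed).exists_isMaxOn
    ⟨w₀, hw₀K, hw₀1, hw₀2⟩ hNcont.continuousOn
  obtain ⟨r, w, h1, h2, h3, h4⟩ := exists_ascent_step hL hsymm hu1 (hδpos.trans_le hu2)
  have hge : N u ≤ N w := by
    have := hpos (powMap p hp w - powMap p hp u)
    rw [h4] at this
    simp only [hNdef]
    linarith
  have hle : N w ≤ N u := by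
    obtain ⟨w', hw'K, hw'1, hw'2⟩ := two w h2 (hu2.trans hge)
    exact hw'2.trans (humax ⟨hw'K, hw'1, (hu2.trans hge).trans hw'2⟩)
  have hzero : L ((powMap p hp w - powMap p hp u) * T (powMap p hp w - powMap p hp u)) = 0 := by
    refine le_antisymm ?_ (hpos _)
    rw [h4]
    simp only [hNdef] at hle
    linarith
  have hT := hdef _ hzero
  rw [map_sub, sub_eq_zero] at hT
  refine ⟨r, w, (hδpos.trans_le hu2).trans_le h1, ?_, by rw [hT, h3]⟩
  rintro rfl
  have h0 : powAbs p hp (0 : C(X, ℝ)) = 0 := by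
    ext x; simp [Real.zero_rpow (by linarith : p + 1 ≠ 0)]
  rw [h0, map_zero] at h2
  exact zero_ne_one h2

end Variational

section Radial

/-- `∫₀^ρ s^{m+1} h(s) ds`. -/
def radInt (m : ℕ) (h : ℝ → ℝ) (ρ : ℝ) : ℝ := ∫ s in (0 : ℝ)..ρ, s ^ (m + 1) * h s

/-- `∫_r^1 ρ^{-(2 * m + 1)} radInt m h ρ dρ`. -/
def radCoef (m : ℕ) (h : ℝ → ℝ) (r : ℝ) : ℝ := ∫ ρ in r..1, radInt m h ρ / ρ ^ (2 * m + 1)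

/-- The solution of `-(r u')' / r + m² u / r² = h` vanishing at `0` and `1`. -/
def radSol (m : ℕ) (h : ℝ → ℝ) (r : ℝ) : ℝ := r ^ m * radCoef m h r

variable {m : ℕ} {h k : ℝ → ℝ}

lemma hasDerivAt_radInt (hh : Continuous h) (ρ : ℝ) :
    HasDerivAt (radInt m h) (ρ ^ (m + 1) * h ρ) ρ := by
  have hc : Continuous fun s : ℝ => s ^ (m + 1) * h s := by fun_prop
  exact intervalIntegral.integral_hasDerivAt_right (hc.intervalIntegrable _ _)
    (hc.stronglyMeasurableAtFilter _ _) hc.continuousAt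

lemma continuous_radInt (hh : Continuous h) : Continuous (radInt m h) :=
  continuous_iff_continuousAt.2 fun ρ => (hasDerivAt_radInt hh ρ).continuousAt

lemma continuousOn_radInt_div (hh : Continuous h) :
    ContinuousOn (fun ρ => radInt m h ρ / ρ ^ (2 * m + 1)) (Set.Ioi 0) :=
  (continuous_radInt hh).continuousOn.div (by fun_prop) fun x hx => pow_ne_zero _ (ne_of_gt hx)

lemma intervalIntegrable_radInt_div (hh : Continuous h) {a b : ℝ} (ha : 0 < a) (hb : 0 < b) :
    IntervalIntegrable (fun ρ => radInt m h ρ / ρ ^ (2 * m + 1)) volume a b :=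
  ((continuousOn_radInt_div hh).mono fun _ hx =>
    (lt_min ha hb).trans_le hx.1).intervalIntegrable

lemma hasDerivAt_radCoef (hh : Continuous h) {r : ℝ} (hr : 0 < r) :
    HasDerivAt (radCoef m h) (-(radInt m h r / r ^ (2 * m + 1))) r :=
  intervalIntegral.integral_hasDerivAt_left (intervalIntegrable_radInt_div hh hr one_pos)
    ((continuousOn_radInt_div hh).stronglyMeasurableAtFilter isOpen_Ioi r hr)
    ((continuousOn_radInt_div hh).continuousAt (Ioi_mem_nhds hr))

lemma radInt_add (hh : Continuous h) (hk : Continuous k) (ρ : ℝ) :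
    radInt m (fun s => h s + k s) ρ = radInt m h ρ + radInt m k ρ := by
  simp only [radInt, mul_add]
  exact intervalIntegral.integral_add ((by fun_prop : Continuous _).intervalIntegrable _ _)
    ((by fun_prop : Continuous _).intervalIntegrable _ _)

lemma radInt_smul (c ρ : ℝ) : radInt m (fun s => c * h s) ρ = c * radInt m h ρ := by
  simp only [radInt, ← intervalIntegral.integral_const_mul]
  congr 1; ext; ring

lemma radSol_zero (hm : m ≠ 0) : radSol m h 0 = 0 := by simp [radSol, hm]

lemma radSol_one : radSol m h 1 = 0 := by simp [radSol, radCoef]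

lemma radSol_add (hm : m ≠ 0) (hh : Continuous h) (hk : Continuous k) {r : ℝ} (hr : 0 ≤ r) :
    radSol m (fun s => h s + k s) r = radSol m h r + radSol m k r := by
  rcases hr.eq_or_lt with rfl | hr
  · simp [radSol_zero hm]
  · simp only [radSol, radCoef, radInt_add hh hk, add_div]
    rw [intervalIntegral.integral_add (intervalIntegrable_radInt_div hh hr one_pos)
      (intervalIntegrable_radInt_div hk hr one_pos), mul_add]

lemma radSol_smul (c r : ℝ) : radSol m (fun s => c * h s) r = c * radSol m h r := by
  simp only [radSol, radCoef, radInt_smul, mul_div_assoc, intervalIntegral.integral_const_mul]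
  ring

lemma abs_radInt_le (hm : m ≠ 0) {B : ℝ} (hB : 0 ≤ B) {d : ℕ}
    (hb : ∀ s ∈ Set.Icc (0 : ℝ) 1, |h s| ≤ B * s ^ d) {ρ : ℝ} (hρ : ρ ∈ Set.Icc (0 : ℝ) 1) :
    |radInt m h ρ| ≤ B / m * ρ ^ (m + (2 + d)) := by
  have h1 : |radInt m h ρ| ≤ ∫ s in (0 : ℝ)..ρ, B * s ^ (m + 1 + d) := by
    rw [← Real.norm_eq_abs]
    refine intervalIntegral.norm_integral_le_of_norm_le hρ.1 (ae_of_all _ fun s hs => ?_)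
      ((by fun_prop : Continuous _).intervalIntegrable _ _)
    have h0 : 0 ≤ s ^ (m + 1) := pow_nonneg hs.1.le _
    rw [Real.norm_eq_abs, abs_mul, abs_of_nonneg h0]
    calc s ^ (m + 1) * |h s| ≤ s ^ (m + 1) * (B * s ^ d) :=
          mul_le_mul_of_nonneg_left (hb s ⟨hs.1.le, hs.2.trans hρ.2⟩) h0
      _ = B * s ^ (m + 1 + d) := by ring
  refine h1.trans ?_
  rw [intervalIntegral.integral_const_mul, integral_pow]
  have hm' : (0 : ℝ) < m := by positivity
  have h2 : (m : ℝ) ≤ ((m + 1 + d : ℕ) : ℝ) + 1 := by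
    push_cast; linarith [(d.cast_nonneg : (0 : ℝ) ≤ d)]
  have h3 : 0 ≤ ρ ^ (m + (2 + d)) := pow_nonneg hρ.1 _
  have h4 : ρ ^ (m + 1 + d + 1) = ρ ^ (m + (2 + d)) := by congr 1; ring
  rw [h4, zero_pow (by positivity), sub_zero, div_mul_eq_mul_div, ← mul_div_assoc]
  gcongr

lemma abs_radSol_le_of_radInt {A : ℝ} (hA : 0 ≤ A) {j : ℕ} (hj : j < m)
    (hb : ∀ ρ ∈ Set.Icc (0 : ℝ) 1, |radInt m h ρ| ≤ A * ρ ^ (m + j)) {r : ℝ}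
    (hr : r ∈ Set.Ioc (0 : ℝ) 1) : r ^ m * |radCoef m h r| ≤ A / (m - j) * r ^ j := by
  obtain ⟨e, rfl⟩ : ∃ e, m = j + (e + 1) := ⟨m - j - 1, by omega⟩
  set m := j + (e + 1) with hmdef
  have h0 : (0 : ℝ) ∉ Set.uIcc r 1 := fun hx => by
    rw [Set.uIcc_of_le hr.2] at hx; exact hr.1.not_ge hx.1
  have h1 : |radCoef m h r| ≤ ∫ ρ in r..1, A * ρ ^ (-(e + 2 : ℤ)) := by
    rw [← Real.norm_eq_abs]
    refine intervalIntegral.norm_integral_le_of_norm_le hr.2 (ae_of_all _ fun s hs => ?_) ?_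
    · have hs0 : 0 < s := hr.1.trans hs.1
      rw [Real.norm_eq_abs, abs_div, abs_of_nonneg (pow_nonneg hs0.le (2 * m + 1)),
        div_le_iff₀ (by positivity)]
      refine (hb s ⟨hs0.le, hs.2⟩).trans_eq ?_
      rw [mul_assoc, ← zpow_natCast, ← zpow_natCast, ← zpow_add₀ hs0.ne']
      congr 2; push_cast [hmdef]; ring
    · exact (intervalIntegral.intervalIntegrable_zpow (Or.inr h0)).const_mul _
  rw [intervalIntegral.integral_const_mul, integral_zpow (Or.inr ⟨by omega, h0⟩), one_zpow] at h1
  have hre : 0 < r ^ (e + 1) := by have := hr.1; positivity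
  have h2 : r ^ (-(e + 2 : ℤ) + 1) = (r ^ (e + 1))⁻¹ := by
    rw [← zpow_natCast, ← zpow_neg]; congr 1
  rw [h2] at h1
  push_cast at h1
  have h3 : ((m : ℕ) : ℝ) - j = e + 1 := by push_cast [hmdef]; ring
  have he : (0 : ℝ) < e + 1 := by positivity
  have h4 : |radCoef m h r| ≤ A * ((r ^ (e + 1))⁻¹ / (e + 1)) := by
    refine h1.trans (mul_le_mul_of_nonneg_left ?_ hA)
    rw [show (-((e : ℝ) + 2) + 1) = -(e + 1) by ring, div_neg, ← neg_div]
    gcongr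
    linarith
  rw [h3]
  calc r ^ m * |radCoef m h r| ≤ r ^ m * (A * ((r ^ (e + 1))⁻¹ / (e + 1))) :=
        mul_le_mul_of_nonneg_left h4 (pow_nonneg hr.1.le _)
    _ = _ := by rw [hmdef, pow_add r j]; field_simp

lemma abs_radCoef_le {B : ℝ} (hB : 0 ≤ B) {d : ℕ} (hm : 2 * (d + 2) ≤ m)
    (hb : ∀ s ∈ Set.Icc (0 : ℝ) 1, |h s| ≤ B * s ^ d) {r : ℝ} (hr : r ∈ Set.Ioc (0 : ℝ) 1) :
    r ^ m * |radCoef m h r| ≤ 2 * B / m ^ 2 * r ^ (2 + d) := by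
  have hm0 : (0 : ℝ) < m := by norm_cast; omega
  refine (abs_radSol_le_of_radInt (by positivity) (by omega)
    (fun ρ hρ => abs_radInt_le (by omega) hB hb hρ) hr).trans ?_
  have h1 : (m : ℝ) / 2 ≤ m - (2 + d : ℕ) := by
    have : (2 * (d + 2) : ℝ) ≤ m := by exact_mod_cast hm
    push_cast; linarith
  refine mul_le_mul_of_nonneg_right ?_ (pow_nonneg hr.1.le _)
  calc B / m / ((m : ℝ) - (2 + d : ℕ)) ≤ B / m / (m / 2) := by gcongr
    _ = _ := by field_simp

lemma abs_radSol_le {B : ℝ} (hB : 0 ≤ B) {d : ℕ} (hm : 2 * (d + 2) ≤ m)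
    (hb : ∀ s ∈ Set.Icc (0 : ℝ) 1, |h s| ≤ B * s ^ d) {r : ℝ} (hr : r ∈ Set.Icc (0 : ℝ) 1) :
    |radSol m h r| ≤ 2 * B / m ^ 2 * r ^ (2 + d) := by
  rcases hr.1.eq_or_lt with rfl | h0
  · rw [radSol_zero (by omega), abs_zero, zero_pow (by omega), mul_zero]
  · rw [radSol, abs_mul, abs_of_nonneg (pow_nonneg h0.le m)]
    exact abs_radCoef_le hB hm hb ⟨h0, hr.2⟩

lemma radSol_lipschitz (hh : Continuous h) {B : ℝ} (hB : 0 ≤ B) (hm : 4 ≤ m)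
    (hb : ∀ s ∈ Set.Icc (0 : ℝ) 1, |h s| ≤ B) {r t : ℝ} (hr : r ∈ Set.Icc (0 : ℝ) 1)
    (ht : t ∈ Set.Icc (0 : ℝ) 1) : |radSol m h r - radSol m h t| ≤ 3 * B * |r - t| := by
  have hb' : ∀ s ∈ Set.Icc (0 : ℝ) 1, |h s| ≤ B * s ^ 0 := by simpa using hb
  have hm1 : (1 : ℝ) ≤ m := by norm_cast; omega
  have key : ∀ x ∈ Set.Ioc (0 : ℝ) 1, ∀ y ∈ Set.Ioc (0 : ℝ) 1,
      |radSol m h x - radSol m h y| ≤ 3 * B * |x - y| := by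
    intro x hx y hy
    refine (convex_Ioc (0 : ℝ) 1).norm_image_sub_le_of_norm_hasDerivWithin_le
      (f := radSol m h) (f' := fun r => m * r ^ (m - 1) * radCoef m h r +
        r ^ m * (-(radInt m h r / r ^ (2 * m + 1)))) (fun r hr => ?_) (fun r hr => ?_) hy hx
    · exact ((hasDerivAt_pow m r).mul (hasDerivAt_radCoef hh hr.1)).hasDerivWithinAt
    · have h0 := hr.1
      have h1 := abs_radCoef_le hB (d := 0) (by omega) hb' hr
      have h2 := abs_radInt_le (m := m) (by omega) hB hb' ⟨hr.1.le, hr.2⟩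
      have e1 : r ^ m = r * r ^ (m - 1) := by rw [← pow_succ']; congr 1; omega
      have h3 : m * r ^ (m - 1) * |radCoef m h r| ≤ 2 * B := by
        rw [e1, add_zero, pow_two r] at h1
        have h4 : r ^ (m - 1) * |radCoef m h r| ≤ 2 * B / m ^ 2 * r := by
          nlinarith
        calc m * r ^ (m - 1) * |radCoef m h r| = m * (r ^ (m - 1) * |radCoef m h r|) := by ring
          _ ≤ m * (2 * B / m ^ 2 * r) := by gcongr
          _ = 2 * B / m * r := by field_simp
          _ ≤ 2 * B / 1 * 1 := by gcongr; exact hr.2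
          _ = 2 * B := by ring
      have h4 : r ^ m * (|radInt m h r| / r ^ (2 * m + 1)) ≤ B := by
        calc r ^ m * (|radInt m h r| / r ^ (2 * m + 1)) ≤
            r ^ m * ((B / m * r ^ (m + (2 + 0))) / r ^ (2 * m + 1)) := by gcongr
          _ = B / m * r := by field_simp; ring
          _ ≤ B / 1 * 1 := by gcongr; exact hr.2
          _ = B := by ring
      rw [Real.norm_eq_abs]
      refine (abs_add_le _ _).trans ?_
      rw [abs_mul (m * r ^ (m - 1)), abs_mul (r ^ m), abs_neg, abs_div,
        abs_of_nonneg (by positivity : 0 ≤ m * r ^ (m - 1)),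
        abs_of_nonneg (by positivity : 0 ≤ r ^ m),
        abs_of_nonneg (by positivity : 0 ≤ r ^ (2 * m + 1))]
      linarith
  have zero : ∀ x ∈ Set.Icc (0 : ℝ) 1, |radSol m h x| ≤ 3 * B * x := by
    intro x hx
    refine (abs_radSol_le hB (d := 0) (by omega) hb' hx).trans ?_
    have : x ^ (2 + 0) ≤ x := by rw [add_zero, pow_two]; nlinarith [hx.1, hx.2]
    have hx0 := hx.1
    calc 2 * B / (m : ℝ) ^ 2 * x ^ (2 + 0) ≤ 2 * B / (1 : ℝ) ^ 2 * x := by gcongr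
      _ ≤ _ := by nlinarith [mul_nonneg hB hx.1]
  rcases hr.1.eq_or_lt with rfl | hr0
  · rw [radSol_zero (by omega), zero_sub, abs_neg, zero_sub, abs_neg, abs_of_nonneg ht.1]
    exact zero t ht
  rcases ht.1.eq_or_lt with rfl | ht0
  · rw [radSol_zero (by omega), sub_zero, sub_zero, abs_of_nonneg hr.1]
    exact zero r hr
  exact key r ⟨hr0, hr.2⟩ t ⟨ht0, ht.2⟩

lemma exists_bound_Icc (hh : Continuous h) :
    ∃ B, 0 ≤ B ∧ ∀ s ∈ Set.Icc (0 : ℝ) 1, |h s| ≤ B := by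
  obtain ⟨B, hB⟩ := isCompact_Icc.exists_bound_of_continuousOn hh.continuousOn
    (s := Set.Icc (0 : ℝ) 1)
  exact ⟨B, (norm_nonneg _).trans (hB 0 ⟨le_rfl, zero_le_one⟩), hB⟩

lemma continuousOn_radSol (hh : Continuous h) (hm : 4 ≤ m) :
    ContinuousOn (radSol m h) (Set.Icc 0 1) := by
  obtain ⟨B, hB, hb⟩ := exists_bound_Icc hh
  refine (LipschitzOnWith.of_dist_le_mul (K := (3 * B).toNNReal) fun x hx y hy => ?_).continuousOn
  rw [Real.dist_eq, Real.dist_eq, Real.coe_toNNReal _ (by positivity)]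
  exact radSol_lipschitz hh hB hm hb hx hy

lemma continuousOn_Icc_of_abs_le {f : ℝ → ℝ} (hf : ContinuousOn f (Set.Ioc 0 1)) (h0 : f 0 = 0)
    {C : ℝ} (hC : ∀ x ∈ Set.Ioc (0 : ℝ) 1, |f x| ≤ C * x) : ContinuousOn f (Set.Icc 0 1) := by
  intro x hx
  rcases hx.1.eq_or_lt with rfl | hx0
  · rw [ContinuousWithinAt, h0]
    refine squeeze_zero_norm' (a := fun x => C * x) ?_ ?_
    · filter_upwards [self_mem_nhdsWithin] with y hy
      rcases hy.1.eq_or_lt with rfl | hy0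
      · simp [h0]
      · exact hC y ⟨hy0, hy.2⟩
    · have : Continuous fun x : ℝ => C * x := by fun_prop
      simpa using (this.tendsto 0).mono_left nhdsWithin_le_nhds
  · refine (hf x ⟨hx0, hx.2⟩).mono_of_mem_nhdsWithin ?_
    filter_upwards [self_mem_nhdsWithin, mem_nhdsWithin_of_mem_nhds (Ioi_mem_nhds hx0)]
      with y hy hy'
    exact ⟨hy', hy.2⟩

lemma radInt_zero : radInt m h 0 = 0 := by simp [radInt]

lemma continuousOn_radInt_mul_div (hh : Continuous h) (hk : Continuous k) (hm : m ≠ 0) :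
    ContinuousOn (fun ρ => radInt m h ρ * radInt m k ρ / ρ ^ (2 * m + 1)) (Set.Icc 0 1) := by
  obtain ⟨B, hB, hb⟩ := exists_bound_Icc hh
  obtain ⟨D, hD, hd⟩ := exists_bound_Icc hk
  have hb' : ∀ s ∈ Set.Icc (0 : ℝ) 1, |h s| ≤ B * s ^ 0 := by simpa using hb
  have hd' : ∀ s ∈ Set.Icc (0 : ℝ) 1, |k s| ≤ D * s ^ 0 := by simpa using hd
  refine continuousOn_Icc_of_abs_le (C := B / m * (D / m)) ?_ (by simp [radInt_zero])
    fun x hx => ?_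
  · exact ((continuous_radInt hh).mul (continuous_radInt hk)).continuousOn.div (by fun_prop)
      fun x hx => pow_ne_zero _ hx.1.ne'
  · have hx0 := hx.1
    have h1 := abs_radInt_le hm hB hb' ⟨hx.1.le, hx.2⟩
    have h2 := abs_radInt_le hm hD hd' ⟨hx.1.le, hx.2⟩
    rw [abs_div, abs_mul, abs_of_nonneg (by positivity : 0 ≤ x ^ (2 * m + 1)),
      div_le_iff₀ (by positivity)]
    calc |radInt m h x| * |radInt m k x|
        ≤ (B / m * x ^ (m + (2 + 0))) * (D / m * x ^ (m + (2 + 0))) := by gcongr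
      _ = B / m * (D / m) * (x ^ (2 * m + 2) * x ^ 2) := by ring
      _ ≤ B / m * (D / m) * (x ^ (2 * m + 2) * 1) := by
          gcongr; exact pow_le_one₀ hx0.le hx.2
      _ = _ := by ring

/-- The Green operator `h ↦ radSol m h` is symmetric and positive for the weight `s ds`. -/
lemma integral_mul_radSol (hh : Continuous h) (hk : Continuous k) (hm : 4 ≤ m) :
    ∫ s in (0 : ℝ)..1, s * h s * radSol m k s =
      ∫ ρ in (0 : ℝ)..1, radInt m h ρ * radInt m k ρ / ρ ^ (2 * m + 1) := by
  obtain ⟨B, hB, hb⟩ := exists_bound_Icc hh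
  obtain ⟨D, hD, hd⟩ := exists_bound_Icc hk
  have hb' : ∀ s ∈ Set.Icc (0 : ℝ) 1, |h s| ≤ B * s ^ 0 := by simpa using hb
  have hd' : ∀ s ∈ Set.Icc (0 : ℝ) 1, |k s| ≤ D * s ^ 0 := by simpa using hd
  have c1 : ContinuousOn (fun s => s * h s * radSol m k s) (Set.Icc 0 1) :=
    (by fun_prop : Continuous fun s : ℝ => s * h s).continuousOn.mul (continuousOn_radSol hk hm)
  have c2 := continuousOn_radInt_mul_div hh hk (m := m) (by omega)
  have i1 : IntervalIntegrable (fun s => s * h s * radSol m k s) volume 0 1 :=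
    ContinuousOn.intervalIntegrable (by rwa [Set.uIcc_of_le zero_le_one])
  have i2 : IntervalIntegrable (fun ρ => radInt m h ρ * radInt m k ρ / ρ ^ (2 * m + 1))
      volume 0 1 := ContinuousOn.intervalIntegrable (by rwa [Set.uIcc_of_le zero_le_one])
  rw [← sub_eq_zero, ← intervalIntegral.integral_sub i1 i2]
  have hderiv : ∀ x ∈ Set.Ioc (0 : ℝ) 1, HasDerivAt (fun x => radInt m h x * radCoef m k x)
      (x * h x * radSol m k x - radInt m h x * radInt m k x / x ^ (2 * m + 1)) x := by
    intro x hx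
    refine ((hasDerivAt_radInt (m := m) hh x).mul
      (hasDerivAt_radCoef (m := m) hk hx.1)).congr_deriv ?_
    simp only [radSol]; ring
  rw [intervalIntegral.integral_eq_sub_of_hasDerivAt_of_le zero_le_one
    (f := fun x => radInt m h x * radCoef m k x) ?_
    (fun x hx => hderiv x ⟨hx.1, hx.2.le⟩) (i1.sub i2)]
  · simp [radInt_zero, radCoef]
  · refine continuousOn_Icc_of_abs_le (C := B / m * (2 * D / m ^ 2))
      (fun x hx => (hderiv x hx).continuousAt.continuousWithinAt) (by simp [radInt_zero])
      fun x hx => ?_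
    have hx0 := hx.1
    have h1 := abs_radInt_le (m := m) (by omega) hB hb' ⟨hx.1.le, hx.2⟩
    have h2 := abs_radCoef_le hD (d := 0) (by omega) hd' hx
    rw [abs_mul]
    calc |radInt m h x| * |radCoef m k x|
        ≤ (B / m * x ^ (m + (2 + 0))) * |radCoef m k x| := by gcongr
      _ = B / m * x ^ 2 * (x ^ m * |radCoef m k x|) := by ring
      _ ≤ B / m * x ^ 2 * (2 * D / m ^ 2 * x ^ (2 + 0)) := by gcongr
      _ = B / m * (2 * D / m ^ 2) * (x * x ^ 3) := by ring
      _ ≤ B / m * (2 * D / m ^ 2) * (x * 1) := by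
          gcongr; exact pow_le_one₀ hx0.le hx.2
      _ = _ := by ring

lemma integral_mul_radSol_self_nonneg (hh : Continuous h) (hm : 4 ≤ m) :
    0 ≤ ∫ s in (0 : ℝ)..1, s * h s * radSol m h s := by
  rw [integral_mul_radSol hh hh hm]
  refine intervalIntegral.integral_nonneg zero_le_one fun x hx => ?_
  exact div_nonneg (mul_self_nonneg _) (pow_nonneg hx.1 _)

lemma radSol_eq_zero_of_integral (hh : Continuous h) (hm : 4 ≤ m)
    (h0 : ∫ s in (0 : ℝ)..1, s * h s * radSol m h s = 0) {r : ℝ} (hr : r ∈ Set.Icc (0 : ℝ) 1) :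
    radSol m h r = 0 := by
  rw [integral_mul_radSol hh hh hm] at h0
  have hW : ∀ ρ ∈ Set.Ioc (0 : ℝ) 1, radInt m h ρ = 0 := by
    intro ρ hρ
    by_contra hne
    refine (intervalIntegral.integral_pos zero_lt_one
      (continuousOn_radInt_mul_div hh hh (m := m) (by omega))
      (fun x hx => div_nonneg (mul_self_nonneg _) (pow_nonneg hx.1.le _))
      ⟨ρ, ⟨hρ.1.le, hρ.2⟩, div_pos (mul_self_pos.2 hne) (pow_pos hρ.1 _)⟩).ne' h0
  rcases hr.1.eq_or_lt with rfl | hr0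
  · exact radSol_zero (by omega)
  · rw [radSol, radCoef, intervalIntegral.integral_congr (g := fun _ => 0),
      intervalIntegral.integral_zero, mul_zero]
    intro x hx
    rw [Set.uIcc_of_le hr.2] at hx
    simp [hW x ⟨hr0.trans_le hx.1, hx.2⟩]

end Radial

/-- The cylinder `[0,1] × [0,2π]` of polar coordinates. -/
abbrev Cyl := Set.Icc (0 : ℝ) 1 × Set.Icc (0 : ℝ) (2 * π)

/-- Constant extension of a function on the cylinder to the plane. -/
def cylExt (a : C(Cyl, ℝ)) (s ψ : ℝ) : ℝ :=
  a (Set.projIcc 0 1 zero_le_one s, Set.projIcc 0 (2 * π) two_pi_pos.le ψ)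

lemma continuous_cylExt (a : C(Cyl, ℝ)) : Continuous fun q : ℝ × ℝ => cylExt a q.1 q.2 :=
  a.continuous.comp ((continuous_projIcc.comp continuous_fst).prodMk
    (continuous_projIcc.comp continuous_snd))

@[fun_prop]
lemma Continuous.cylExt {Y : Type*} [TopologicalSpace Y] (a : C(Cyl, ℝ)) {f g : Y → ℝ}
    (hf : Continuous f) (hg : Continuous g) : Continuous fun y => cylExt a (f y) (g y) :=
  (continuous_cylExt a).comp (hf.prodMk hg)

lemma abs_cylExt_le (a : C(Cyl, ℝ)) (s ψ : ℝ) : |cylExt a s ψ| ≤ ‖a‖ := a.norm_coe_le_norm _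

lemma cylExt_mk (a : C(Cyl, ℝ)) {s ψ : ℝ} (hs : s ∈ Set.Icc (0 : ℝ) 1)
    (hψ : ψ ∈ Set.Icc (0 : ℝ) (2 * π)) : cylExt a s ψ = a (⟨s, hs⟩, ⟨ψ, hψ⟩) := by
  rw [cylExt, Set.projIcc_of_mem _ hs, Set.projIcc_of_mem _ hψ]

/-- The `k`-th sine coefficient of `g` on `[0, 2π]`. -/
def sinCoef (k : ℕ) (g : ℝ → ℝ) : ℝ := π⁻¹ * ∫ ψ in (0 : ℝ)..2 * π, g ψ * sin (k * ψ)

/-- The source term of the `k`-th mode. -/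
def modeSrc (α : ℝ) (k : ℕ) (g : ℝ → ℝ → ℝ) (s : ℝ) : ℝ := s ^ α * sinCoef k (g s)

lemma continuous_rpow_mul_integral {α : ℝ} (hα : 0 ≤ α) {F : ℝ → ℝ → ℝ}
    (hF : Continuous fun q : ℝ × ℝ => F q.1 q.2) :
    Continuous fun s : ℝ => s ^ α * ∫ ψ in (0 : ℝ)..2 * π, F s ψ :=
  (Real.continuous_rpow_const hα).mul
    (intervalIntegral.continuous_parametric_intervalIntegral_of_continuous' hF _ _)

lemma continuous_modeSrc {α : ℝ} (hα : 0 ≤ α) (k : ℕ) {g : ℝ → ℝ → ℝ}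
    (hg : Continuous fun q : ℝ × ℝ => g q.1 q.2) : Continuous (modeSrc α k g) := by
  have := (continuous_rpow_mul_integral hα (F := fun s ψ => g s ψ * sin (k * ψ))
    (hg.mul (by fun_prop))).const_mul π⁻¹
  refine this.congr fun s => ?_
  simp only [modeSrc, sinCoef]; ring

lemma abs_sinCoef_le (k : ℕ) {g : ℝ → ℝ} {M : ℝ} (hM : ∀ ψ ∈ Set.Icc 0 (2 * π), |g ψ| ≤ M) :
    |sinCoef k g| ≤ 2 * M := by
  have h : ‖∫ ψ in (0 : ℝ)..2 * π, g ψ * sin (k * ψ)‖ ≤ M * |2 * π - 0| := by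
    refine intervalIntegral.norm_integral_le_of_norm_le_const fun ψ hψ => ?_
    rw [Set.uIoc_of_le two_pi_pos.le] at hψ
    rw [Real.norm_eq_abs, abs_mul]
    have := hM ψ ⟨hψ.1.le, hψ.2⟩
    nlinarith [abs_sin_le_one (k * ψ), abs_nonneg (g ψ), abs_nonneg (sin (k * ψ))]
  rw [sinCoef, abs_mul, abs_of_pos (inv_pos.2 pi_pos)]
  rw [Real.norm_eq_abs, sub_zero, abs_of_pos two_pi_pos] at h
  calc π⁻¹ * _ ≤ π⁻¹ * (M * (2 * π)) := by gcongr
    _ = 2 * M := by field_simp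

lemma abs_modeSrc_le {α : ℝ} (hα : 0 ≤ α) (k : ℕ) {g : ℝ → ℝ → ℝ} {s M : ℝ}
    (hs : s ∈ Set.Icc (0 : ℝ) 1) (hM : |sinCoef k (g s)| ≤ M) : |modeSrc α k g s| ≤ M := by
  rw [modeSrc, abs_mul, abs_of_nonneg (Real.rpow_nonneg hs.1 _)]
  calc s ^ α * |sinCoef k (g s)| ≤ 1 * M := by
        gcongr
        exact Real.rpow_le_one hs.1 hs.2 hα
    _ = M := one_mul M

lemma abs_modeSrc_cylExt_le {α : ℝ} (hα : 0 ≤ α) (k : ℕ) (a : C(Cyl, ℝ)) {s : ℝ}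
    (hs : s ∈ Set.Icc (0 : ℝ) 1) : |modeSrc α k (cylExt a) s| ≤ 2 * ‖a‖ :=
  abs_modeSrc_le hα k hs (abs_sinCoef_le k fun _ _ => abs_cylExt_le a _ _)

lemma sinCoef_add (k : ℕ) {f g : ℝ → ℝ} (hf : Continuous f) (hg : Continuous g) :
    sinCoef k (fun x => f x + g x) = sinCoef k f + sinCoef k g := by
  simp only [sinCoef, add_mul]
  rw [intervalIntegral.integral_add ((by fun_prop : Continuous _).intervalIntegrable _ _)
    ((by fun_prop : Continuous _).intervalIntegrable _ _), mul_add]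

lemma sinCoef_const_mul (k : ℕ) (c : ℝ) (f : ℝ → ℝ) :
    sinCoef k (fun x => c * f x) = c * sinCoef k f := by
  simp only [sinCoef, mul_assoc, intervalIntegral.integral_const_mul]
  ring

lemma abs_radSol_modeSrc_le {α : ℝ} (hα : 0 ≤ α) {m : ℕ} (hm : 4 ≤ m) (k : ℕ) (a : C(Cyl, ℝ))
    {r : ℝ} (hr : r ∈ Set.Icc (0 : ℝ) 1) :
    |radSol m (modeSrc α k (cylExt a)) r| ≤ 4 / m ^ 2 * ‖a‖ := by
  refine (abs_radSol_le (d := 0) (B := 2 * ‖a‖) (by positivity) (by omega)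
    (by simpa using fun s h0 h1 => abs_modeSrc_cylExt_le hα k a ⟨h0, h1⟩) hr).trans ?_
  calc 2 * (2 * ‖a‖) / m ^ 2 * r ^ (2 + 0) ≤ 2 * (2 * ‖a‖) / m ^ 2 * 1 := by
        gcongr
        exact pow_le_one₀ hr.1 hr.2
    _ = 4 / m ^ 2 * ‖a‖ := by ring

/-- The solution operator of the mode `sin (k ψ)` with radial exponent `m`. -/
def modeOp {α : ℝ} (hα : 0 ≤ α) {m : ℕ} (hm : 4 ≤ m) (k : ℕ) : C(Cyl, ℝ) →L[ℝ] C(Cyl, ℝ) :=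
  LinearMap.mkContinuous
    { toFun := fun a =>
        { toFun := fun x => radSol m (modeSrc α k (cylExt a)) x.1 * sin (k * x.2)
          continuous_toFun := by
            refine Continuous.mul ?_ (by fun_prop)
            exact ((continuousOn_radSol (continuous_modeSrc hα k (continuous_cylExt a))
              hm).comp_continuous
              (continuous_subtype_val.comp continuous_fst) fun x => x.1.2) }
      map_add' := fun a b => by
        ext x
        have : modeSrc α k (cylExt (a + b)) =
            fun s => modeSrc α k (cylExt a) s + modeSrc α k (cylExt b) s := by
          ext s
          simp only [modeSrc, ← mul_add]
          rw [← sinCoef_add k (by fun_prop) (by fun_prop)]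
          rfl
        simp only [ContinuousMap.coe_mk, ContinuousMap.add_apply]
        rw [this, radSol_add (by omega) (continuous_modeSrc hα k (continuous_cylExt a))
          (continuous_modeSrc hα k (continuous_cylExt b)) x.1.2.1, add_mul]
      map_smul' := fun c a => by
        ext x
        have : modeSrc α k (cylExt (c • a)) = fun s => c * modeSrc α k (cylExt a) s := by
          ext s
          simp only [modeSrc]
          rw [mul_left_comm, ← sinCoef_const_mul k c]
          rfl
        simp only [ContinuousMap.coe_mk, ContinuousMap.smul_apply, RingHom.id_apply, smul_eq_mul]
        rw [this, radSol_smul, mul_assoc] }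
    (4 / m ^ 2) fun a => by
      rw [ContinuousMap.norm_le _ (by positivity)]
      intro x
      simp only [LinearMap.coe_mk, AddHom.coe_mk, ContinuousMap.coe_mk, Real.norm_eq_abs, abs_mul]
      exact (mul_le_of_le_one_right (abs_nonneg _) (abs_sin_le_one _)).trans
        (abs_radSol_modeSrc_le hα hm k a x.1.2)

lemma modeOp_apply {α : ℝ} (hα : 0 ≤ α) {m : ℕ} (hm : 4 ≤ m) (k : ℕ) (a : C(Cyl, ℝ)) (x : Cyl) :
    modeOp hα hm k a x = radSol m (modeSrc α k (cylExt a)) x.1 * sin (k * x.2) := rfl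

lemma norm_modeOp_le {α : ℝ} (hα : 0 ≤ α) {m : ℕ} (hm : 4 ≤ m) (k : ℕ) :
    ‖modeOp hα hm k‖ ≤ 4 / m ^ 2 :=
  LinearMap.mkContinuous_norm_le _ (by positivity) _

lemma isCompact_setOf_lipschitz (M K : ℝ) :
    IsCompact {f : C(Cyl, ℝ) | (∀ x, |f x| ≤ M) ∧ ∀ x y, |f x - f y| ≤ K * dist x y} := by
  refine ArzelaAscoli.isCompact_of_equicontinuous _ ?_ ?_
  · have h1 : IsCompact (Set.univ.pi fun _ : Cyl => Set.Icc (-M) M) :=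
      isCompact_univ_pi fun _ => isCompact_Icc
    have h2 : IsClosed {f : Cyl → ℝ | ∀ x y, |f x - f y| ≤ K * dist x y} := by
      simp only [Set.ofPred_forall]
      exact isClosed_iInter fun x => isClosed_iInter fun y =>
        isClosed_le (by fun_prop) continuous_const
    convert h1.inter_right h2 using 1
    ext f
    constructor
    · rintro ⟨g, hg, rfl⟩
      exact ⟨fun x _ => abs_le.1 (hg.1 x), hg.2⟩
    · rintro ⟨hf1, hf2⟩
      refine ⟨⟨f, ?_⟩, ⟨fun x => abs_le.2 (hf1 x trivial), hf2⟩, rfl⟩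
      refine (LipschitzWith.of_dist_le_mul (K := K.toNNReal) fun x y => ?_).continuous
      rw [Real.dist_eq]
      exact (hf2 x y).trans (mul_le_mul_of_nonneg_right (Real.le_coe_toNNReal K) dist_nonneg)
  · refine Metric.equicontinuous_of_continuity_modulus (fun t => K * t) ?_ _ ?_
    · simpa using (tendsto_id (α := ℝ) (x := 𝓝 0)).const_mul K
    · rintro x y ⟨f, hf⟩
      exact hf.2 x y

lemma isCompactOperator_modeOp {α : ℝ} (hα : 0 ≤ α) {m : ℕ} (hm : 4 ≤ m) (k : ℕ) :
    IsCompactOperator (modeOp hα hm k) := by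
  refine ⟨_, isCompact_setOf_lipschitz (4 / m ^ 2) (6 + 4 / m ^ 2 * k), ?_⟩
  filter_upwards [closedBall_mem_nhds (0 : C(Cyl, ℝ)) one_pos] with a ha
  rw [mem_closedBall_zero_iff] at ha
  have hb : ∀ r ∈ Set.Icc (0 : ℝ) 1, |radSol m (modeSrc α k (cylExt a)) r| ≤ 4 / m ^ 2 :=
    fun r hr => (abs_radSol_modeSrc_le hα hm k a hr).trans
      (mul_le_of_le_one_right (by positivity) ha)
  constructor
  · intro x
    rw [modeOp_apply, abs_mul]
    exact (mul_le_of_le_one_right (abs_nonneg _) (abs_sin_le_one _)).trans (hb _ x.1.2)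
  · intro x y
    have hx : |(x.1 : ℝ) - y.1| ≤ dist x y := le_max_left _ _
    have hy : |(x.2 : ℝ) - y.2| ≤ dist x y := le_max_right _ _
    have hl := radSol_lipschitz (m := m) (continuous_modeSrc hα k (continuous_cylExt a))
      (B := 2) zero_le_two hm
      (fun s hs => (abs_modeSrc_cylExt_le hα k a hs).trans (by linarith)) x.1.2 y.1.2
    have hs : |sin (k * (x.2 : ℝ)) - sin (k * (y.2 : ℝ))| ≤ k * |(x.2 : ℝ) - y.2| := by
      have := Real.abs_sin_sub_sin_le (k * (x.2 : ℝ)) (k * (y.2 : ℝ))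
      rwa [← mul_sub, abs_mul, Nat.abs_cast] at this
    rw [modeOp_apply, modeOp_apply]
    set R := radSol m (modeSrc α k (cylExt a))
    calc |R x.1 * sin (k * x.2) - R y.1 * sin (k * y.2)|
        = |(R x.1 - R y.1) * sin (k * x.2) + R y.1 * (sin (k * x.2) - sin (k * y.2))| := by
          congr 1; ring
      _ ≤ |R x.1 - R y.1| * |sin (k * x.2)| + |R y.1| * |sin (k * x.2) - sin (k * y.2)| := by
          rw [← abs_mul, ← abs_mul]; exact abs_add_le _ _
      _ ≤ (3 * 2 * dist x y) * 1 + 4 / m ^ 2 * (k * dist x y) := by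
          gcongr
          · exact hl.trans (by gcongr)
          · exact abs_sin_le_one _
          · exact hb _ y.1.2
          · exact hs.trans (by gcongr)
      _ = (6 + 4 / m ^ 2 * k) * dist x y := by ring

/-- The measure `s^{1+α} ds dψ` as a functional. -/
def cylIntegral {α : ℝ} (hα : 0 ≤ α) : C(Cyl, ℝ) →L[ℝ] ℝ :=
  LinearMap.mkContinuous
    { toFun := fun a => ∫ s in (0 : ℝ)..1, s * (s ^ α * ∫ ψ in (0 : ℝ)..2 * π, cylExt a s ψ)
      map_add' := fun a b => by
        have hc : ∀ a : C(Cyl, ℝ), Continuous fun s : ℝ =>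
            s * (s ^ α * ∫ ψ in (0 : ℝ)..2 * π, cylExt a s ψ) := fun a =>
          continuous_id.mul (continuous_rpow_mul_integral hα (continuous_cylExt a))
        rw [← intervalIntegral.integral_add ((hc a).intervalIntegrable _ _)
          ((hc b).intervalIntegrable _ _)]
        congr 1; ext s
        rw [← mul_add, ← mul_add, ← intervalIntegral.integral_add
          ((by fun_prop : Continuous (cylExt a s)).intervalIntegrable _ _)
          ((by fun_prop : Continuous (cylExt b s)).intervalIntegrable _ _)]
        rfl
      map_smul' := fun c a => by
        rw [RingHom.id_apply, smul_eq_mul, ← intervalIntegral.integral_const_mul]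
        congr 1; ext s
        rw [mul_left_comm c, mul_left_comm c, ← intervalIntegral.integral_const_mul c]
        rfl }
    (2 * π) fun a => by
      have h : ∀ s ∈ Set.uIoc (0 : ℝ) 1,
          ‖s * (s ^ α * ∫ ψ in (0 : ℝ)..2 * π, cylExt a s ψ)‖ ≤ 2 * π * ‖a‖ := by
        intro s hs
        rw [Set.uIoc_of_le zero_le_one] at hs
        have h1 : ‖∫ ψ in (0 : ℝ)..2 * π, cylExt a s ψ‖ ≤ ‖a‖ * |2 * π - 0| :=
          intervalIntegral.norm_integral_le_of_norm_le_const fun ψ _ => abs_cylExt_le a s ψ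
        rw [sub_zero, abs_of_pos two_pi_pos] at h1
        rw [norm_mul, norm_mul, Real.norm_of_nonneg hs.1.le,
          Real.norm_of_nonneg (Real.rpow_nonneg hs.1.le _)]
        calc s * (s ^ α * _) ≤ 1 * (1 * (‖a‖ * (2 * π))) := by
              gcongr
              · have := Real.rpow_nonneg hs.1.le α
                positivity
              · exact hs.2
              · exact Real.rpow_le_one hs.1.le hs.2 hα
          _ = 2 * π * ‖a‖ := by ring
      simpa using intervalIntegral.norm_integral_le_of_norm_le_const h

lemma cylIntegral_apply {α : ℝ} (hα : 0 ≤ α) (a : C(Cyl, ℝ)) : cylIntegral hα a =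
    ∫ s in (0 : ℝ)..1, s * (s ^ α * ∫ ψ in (0 : ℝ)..2 * π, cylExt a s ψ) := rfl

lemma cylIntegral_nonneg {α : ℝ} (hα : 0 ≤ α) {a : C(Cyl, ℝ)} (ha : 0 ≤ a) :
    0 ≤ cylIntegral hα a := by
  refine intervalIntegral.integral_nonneg zero_le_one fun s hs => ?_
  exact mul_nonneg hs.1 (mul_nonneg (Real.rpow_nonneg hs.1 _)
    (intervalIntegral.integral_nonneg two_pi_pos.le fun ψ _ => ha _))

lemma cylIntegral_mul_modeOp {α : ℝ} (hα : 0 ≤ α) {m : ℕ} (hm : 4 ≤ m) (k : ℕ) (a b : C(Cyl, ℝ)) :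
    cylIntegral hα (a * modeOp hα hm k b) = π * ∫ s in (0 : ℝ)..1,
      s * modeSrc α k (cylExt a) s * radSol m (modeSrc α k (cylExt b)) s := by
  rw [cylIntegral_apply, ← intervalIntegral.integral_const_mul]
  refine intervalIntegral.integral_congr fun s hs => ?_
  rw [Set.uIcc_of_le zero_le_one] at hs
  have : ∫ ψ in (0 : ℝ)..2 * π, cylExt (a * modeOp hα hm k b) s ψ =
      ∫ ψ in (0 : ℝ)..2 * π, (cylExt a s ψ * sin (k * ψ)) *
        radSol m (modeSrc α k (cylExt b)) s := by
    refine intervalIntegral.integral_congr fun ψ hψ => ?_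
    rw [Set.uIcc_of_le two_pi_pos.le] at hψ
    simp only [cylExt_mk _ hs hψ, ContinuousMap.mul_apply, modeOp_apply]
    ring
  simp only [this, intervalIntegral.integral_mul_const]
  rw [modeSrc, sinCoef]
  have := pi_pos.ne'
  field_simp

lemma cylIntegral_mul_modeOp_comm {α : ℝ} (hα : 0 ≤ α) {m : ℕ} (hm : 4 ≤ m) (k : ℕ)
    (a b : C(Cyl, ℝ)) :
    cylIntegral hα (a * modeOp hα hm k b) = cylIntegral hα (b * modeOp hα hm k a) := by
  have ha := continuous_modeSrc hα k (continuous_cylExt a)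
  have hb := continuous_modeSrc hα k (continuous_cylExt b)
  rw [cylIntegral_mul_modeOp, cylIntegral_mul_modeOp, integral_mul_radSol ha hb hm,
    integral_mul_radSol hb ha hm]
  simp only [mul_comm (radInt m (modeSrc α k (cylExt a)) _)]

lemma cylIntegral_mul_modeOp_nonneg {α : ℝ} (hα : 0 ≤ α) {m : ℕ} (hm : 4 ≤ m) (k : ℕ)
    (a : C(Cyl, ℝ)) : 0 ≤ cylIntegral hα (a * modeOp hα hm k a) := by
  rw [cylIntegral_mul_modeOp]
  exact mul_nonneg pi_pos.le
    (integral_mul_radSol_self_nonneg (continuous_modeSrc hα k (continuous_cylExt a)) hm)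

lemma modeOp_eq_zero {α : ℝ} (hα : 0 ≤ α) {m : ℕ} (hm : 4 ≤ m) (k : ℕ) {a : C(Cyl, ℝ)}
    (h : cylIntegral hα (a * modeOp hα hm k a) = 0) : modeOp hα hm k a = 0 := by
  rw [cylIntegral_mul_modeOp, mul_eq_zero, or_iff_right pi_pos.ne'] at h
  ext x
  rw [modeOp_apply, radSol_eq_zero_of_integral
    (continuous_modeSrc hα k (continuous_cylExt a)) hm h x.1.2, zero_mul, ContinuousMap.zero_apply]

lemma four_le_mul_odd {n : ℕ} (hn : 4 ≤ n) (i : ℕ) : 4 ≤ n * (2 * i + 1) := by nlinarith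

lemma succ_le_mul_odd {n : ℕ} (hn : 4 ≤ n) (i : ℕ) : (i : ℝ) + 1 ≤ (n * (2 * i + 1) : ℕ) := by
  exact_mod_cast (by nlinarith : i + 1 ≤ n * (2 * i + 1))

lemma summable_succ_rpow {q : ℝ} (hq : 1 < q) : Summable fun i : ℕ => ((i : ℝ) + 1) ^ (-q) := by
  have := (summable_nat_add_iff 1).2 (Real.summable_nat_rpow.2 (neg_lt_neg hq))
  exact_mod_cast this

lemma mul_odd_rpow_le {n : ℕ} (hn : 4 ≤ n) (i : ℕ) {q : ℝ} (hq : 0 ≤ q) :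
    ((n * (2 * i + 1) : ℕ) : ℝ) ^ (-q) ≤ ((i : ℝ) + 1) ^ (-q) :=
  Real.rpow_le_rpow_of_nonpos (by positivity) (succ_le_mul_odd hn i) (neg_nonpos.2 hq)

lemma summable_clm_of_norm_le {F : Type*} [NormedAddCommGroup F] [NormedSpace ℝ F]
    [CompleteSpace F] {f : ℕ → F →L[ℝ] F} {g : ℕ → ℝ} (hg : Summable g)
    (h : ∀ i, ‖f i‖ ≤ g i) : Summable f :=
  Summable.of_norm_bounded hg h

/-- The solution operator of the linear problem in the class of functions that are odd and
antiperiodic in the angle. -/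
def solOp {α : ℝ} (hα : 0 ≤ α) {n : ℕ} (hn : 4 ≤ n) : C(Cyl, ℝ) →L[ℝ] C(Cyl, ℝ) :=
  ∑' i : ℕ, modeOp hα (four_le_mul_odd hn i) (2 * i + 1)

section

variable {α : ℝ} (hα : 0 ≤ α) {n : ℕ} (hn : 4 ≤ n)

lemma hasSum_modeOp :
    HasSum (fun i : ℕ => modeOp hα (four_le_mul_odd hn i) (2 * i + 1)) (solOp hα hn) := by
  refine (summable_clm_of_norm_le ((summable_succ_rpow one_lt_two).mul_left 4) fun i => ?_).hasSum
  have h : ((i : ℝ) + 1) ^ (-2 : ℝ) = (((i : ℝ) + 1) ^ 2)⁻¹ := by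
    rw [Real.rpow_neg (by positivity), Real.rpow_two]
  refine (norm_modeOp_le hα _ _).trans ?_
  rw [h, div_eq_mul_inv]
  gcongr
  exact succ_le_mul_odd hn i

lemma hasSum_modeOp_apply (a : C(Cyl, ℝ)) :
    HasSum (fun i : ℕ => modeOp hα (four_le_mul_odd hn i) (2 * i + 1) a) (solOp hα hn a) :=
  (hasSum_modeOp hα hn).mapL (ContinuousLinearMap.apply ℝ _ a)

lemma hasSum_cylIntegral_mul_modeOp (a b : C(Cyl, ℝ)) :
    HasSum (fun i : ℕ => cylIntegral hα (a * modeOp hα (four_le_mul_odd hn i) (2 * i + 1) b))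
      (cylIntegral hα (a * solOp hα hn b)) :=
  ((hasSum_modeOp_apply hα hn b).mul_left a).mapL (cylIntegral hα)

lemma hasSum_radSol_mul_sin (a : C(Cyl, ℝ)) (x : Cyl) :
    HasSum (fun i : ℕ => radSol (n * (2 * i + 1)) (modeSrc α (2 * i + 1) (cylExt a)) x.1 *
      sin ((2 * i + 1 : ℕ) * x.2)) (solOp hα hn a x) :=
  (hasSum_modeOp_apply hα hn a).mapL (ContinuousMap.evalCLM ℝ x)

lemma isCompactOperator_solOp : IsCompactOperator (solOp hα hn) := by
  refine isCompactOperator_of_tendsto (hasSum_modeOp hα hn) (Eventually.of_forall fun s => ?_)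
  induction s using Finset.cons_induction with
  | empty => simpa using isCompactOperator_zero
  | cons i s hi ih =>
    rw [Finset.sum_cons]
    exact (isCompactOperator_modeOp hα _ _).add ih

end

lemma mul_le_add_rpow {x y c : ℝ} (hx : 0 ≤ x) (hy : 0 ≤ y) (hc : 0 < c) :
    x * y ≤ c ^ 2 * x ^ 3 + c⁻¹ * y ^ (3 / 2 : ℝ) := by
  rcases le_total y (c ^ 2 * x ^ 2) with h | h
  · have : 0 ≤ c⁻¹ * y ^ (3 / 2 : ℝ) := by positivity
    nlinarith [mul_le_mul_of_nonneg_left h hx]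
  · have h1 : c * x ≤ √y := Real.le_sqrt_of_sq_le (by rw [mul_pow]; exact h)
    have h2 : y ^ (3 / 2 : ℝ) = y * √y := by
      rcases hy.eq_or_lt with rfl | hy
      · simp
      · rw [Real.sqrt_eq_rpow, ← Real.rpow_one_add' hy.le (by norm_num)]; norm_num
    have h3 : x * y ≤ c⁻¹ * (y * √y) := by
      rw [le_inv_mul_iff₀ hc]
      nlinarith
    rw [h2]
    have : 0 ≤ c ^ 2 * x ^ 3 := by positivity
    linarith

lemma abs_radInt_modeSrc_le {α : ℝ} (hα : 0 ≤ α) {m : ℕ} (hm : m ≠ 0) (k : ℕ) {g G : C(Cyl, ℝ)}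
    (hG : ∀ x, |g x| ^ (3 / 2 : ℝ) ≤ G x) {ρ : ℝ} (hρ : ρ ∈ Set.Icc (0 : ℝ) 1) :
    |radInt m (modeSrc α k (cylExt g)) ρ| ≤
      (2 + cylIntegral hα G) * (m : ℝ) ^ (-(1 / 3) : ℝ) * ρ ^ m := by
  rcases hρ.1.eq_or_lt with rfl | hρ0
  · simp [radInt_zero, hm]
  have hm0 : (0 : ℝ) < m := by positivity
  set c : ℝ := (m : ℝ) ^ (1 / 3 : ℝ) with hc
  have hc0 : 0 < c := by positivity
  have hcm : c ^ 3 = m := by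
    rw [hc, ← Real.rpow_natCast, ← Real.rpow_mul hm0.le]; norm_num
  have hci : (m : ℝ) ^ (-(1 / 3) : ℝ) = c⁻¹ := by rw [hc, Real.rpow_neg hm0.le]
  have hG0 : ∀ x, 0 ≤ G x := fun x => (Real.rpow_nonneg (abs_nonneg _) _).trans (hG x)
  set I : ℝ → ℝ := fun s => s * (s ^ α * ∫ ψ in (0 : ℝ)..2 * π, cylExt G s ψ) with hI
  have hIc : Continuous I :=
    continuous_id.mul (continuous_rpow_mul_integral hα (continuous_cylExt G))
  have hI0 : ∀ s ∈ Set.Icc (0 : ℝ) 1, 0 ≤ I s := fun s hs =>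
    mul_nonneg hs.1 (mul_nonneg (Real.rpow_nonneg hs.1 _)
      (intervalIntegral.integral_nonneg two_pi_pos.le fun ψ _ => hG0 _))
  have hpt : ∀ s ∈ Set.Ioc 0 ρ, |s ^ (m + 1) * modeSrc α k (cylExt g) s| ≤
      ρ ^ m * (2 * c ^ 2 * (s / ρ) ^ (3 * m) + c⁻¹ * I s) := by
    intro s hs
    have hs1 : s ≤ 1 := hs.2.trans hρ.2
    set x : ℝ := (s / ρ) ^ m with hx
    have hx0 : 0 ≤ x := by have := hs.1; positivity
    have hx3 : (s / ρ) ^ (3 * m) = x ^ 3 := by rw [hx, ← pow_mul, mul_comm]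
    have hsx : s ^ m = ρ ^ m * x := by rw [hx, ← mul_pow, mul_div_cancel₀ _ hρ0.ne']
    have hsα : 0 ≤ s ^ α := Real.rpow_nonneg hs.1.le _
    have hint : x * |∫ ψ in (0 : ℝ)..2 * π, cylExt g s ψ * sin (k * ψ)| ≤
        2 * π * (c ^ 2 * x ^ 3) + c⁻¹ * ∫ ψ in (0 : ℝ)..2 * π, cylExt G s ψ := by
      rw [← abs_of_nonneg hx0, ← abs_mul, ← intervalIntegral.integral_const_mul, abs_of_nonneg hx0,
        ← Real.norm_eq_abs]
      have hc1 : Continuous fun ψ => c ^ 2 * x ^ 3 + c⁻¹ * cylExt G s ψ := by fun_prop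
      refine (intervalIntegral.norm_integral_le_of_norm_le two_pi_pos.le
        (g := fun ψ => c ^ 2 * x ^ 3 + c⁻¹ * cylExt G s ψ)
        (Eventually.of_forall fun ψ _ => ?_) (hc1.intervalIntegrable _ _)).trans_eq ?_
      · rw [Real.norm_eq_abs, abs_mul, abs_mul, abs_of_nonneg hx0]
        calc x * (|cylExt g s ψ| * |sin (k * ψ)|) ≤ x * (|cylExt g s ψ| * 1) := by
              gcongr; exact abs_sin_le_one _
          _ ≤ c ^ 2 * x ^ 3 + c⁻¹ * |cylExt g s ψ| ^ (3 / 2 : ℝ) := by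
              rw [mul_one]; exact mul_le_add_rpow hx0 (abs_nonneg _) hc0
          _ ≤ c ^ 2 * x ^ 3 + c⁻¹ * cylExt G s ψ := by gcongr; exact hG _
      · rw [intervalIntegral.integral_add (by simp)
          ((by fun_prop : Continuous _).intervalIntegrable _ _),
          intervalIntegral.integral_const_mul, intervalIntegral.integral_const_mul,
          intervalIntegral.integral_const, sub_zero, smul_eq_mul]
        ring
    have hπ1 : π⁻¹ ≤ 1 := inv_le_one_of_one_le₀ (by linarith [pi_gt_three])
    rw [modeSrc, sinCoef, abs_mul, abs_mul, abs_mul, abs_of_nonneg hsα,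
      abs_of_pos (inv_pos.2 pi_pos), abs_of_nonneg (pow_nonneg hs.1.le _), hx3, pow_succ, hsx, hI]
    have hJ : 0 ≤ ∫ ψ in (0 : ℝ)..2 * π, cylExt G s ψ :=
      intervalIntegral.integral_nonneg two_pi_pos.le fun ψ _ => hG0 _
    set J := ∫ ψ in (0 : ℝ)..2 * π, cylExt G s ψ
    have hsα1 : s ^ α ≤ 1 := Real.rpow_le_one hs.1.le hs1 hα
    have hs0 := hs.1.le
    calc ρ ^ m * x * s * (s ^ α * (π⁻¹ * |∫ ψ in (0 : ℝ)..2 * π, cylExt g s ψ * sin (k * ψ)|))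
        = ρ ^ m * (s * s ^ α * (π⁻¹ *
          (x * |∫ ψ in (0 : ℝ)..2 * π, cylExt g s ψ * sin (k * ψ)|))) := by ring
      _ ≤ ρ ^ m * (s * s ^ α * (π⁻¹ * (2 * π * (c ^ 2 * x ^ 3) + c⁻¹ * J))) := by gcongr
      _ = ρ ^ m * (s * s ^ α * (2 * c ^ 2 * x ^ 3) + π⁻¹ * (c⁻¹ * (s * (s ^ α * J)))) := by
          have := pi_pos.ne'
          field_simp
      _ ≤ ρ ^ m * (1 * 1 * (2 * c ^ 2 * x ^ 3) + 1 * (c⁻¹ * (s * (s ^ α * J)))) := by gcongr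
      _ = _ := by ring
  have hcont : Continuous fun s => ρ ^ m * (2 * c ^ 2 * (s / ρ) ^ (3 * m) + c⁻¹ * I s) := by
    fun_prop
  have h1 : |radInt m (modeSrc α k (cylExt g)) ρ| ≤
      ∫ s in (0 : ℝ)..ρ, ρ ^ m * (2 * c ^ 2 * (s / ρ) ^ (3 * m) + c⁻¹ * I s) := by
    rw [← Real.norm_eq_abs]
    exact intervalIntegral.norm_integral_le_of_norm_le hρ.1 (Eventually.of_forall hpt)
      (hcont.intervalIntegrable _ _)
  have h2 : ∫ s in (0 : ℝ)..ρ, I s ≤ cylIntegral hα G :=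
    intervalIntegral.integral_mono_interval le_rfl hρ.1 hρ.2
      ((ae_restrict_iff' measurableSet_Ioc).2
        (Eventually.of_forall fun s hs => hI0 s ⟨hs.1.le, hs.2⟩))
      (hIc.intervalIntegrable _ _)
  have h3 : ∫ s in (0 : ℝ)..ρ, (s / ρ) ^ (3 * m) ≤ (m : ℝ)⁻¹ := by
    rw [intervalIntegral.integral_comp_div (fun s => s ^ (3 * m)) hρ0.ne', zero_div,
      div_self hρ0.ne', integral_pow, smul_eq_mul, one_pow, zero_pow (by omega), sub_zero, one_div]
    calc ρ * ((3 * m : ℕ) + 1 : ℝ)⁻¹ ≤ 1 * (m : ℝ)⁻¹ := by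
          gcongr
          · exact hρ.2
          · push_cast; linarith
      _ = _ := one_mul _
  have h4 : c ^ 2 * (m : ℝ)⁻¹ = c⁻¹ := by rw [← hcm]; field_simp
  refine h1.trans ?_
  rw [intervalIntegral.integral_const_mul, intervalIntegral.integral_add
    ((by fun_prop : Continuous _).intervalIntegrable _ _)
    ((by fun_prop : Continuous _).intervalIntegrable _ _),
    intervalIntegral.integral_const_mul, intervalIntegral.integral_const_mul, hci]
  calc ρ ^ m * (2 * c ^ 2 * _ + c⁻¹ * _)
      ≤ ρ ^ m * (2 * c ^ 2 * (m : ℝ)⁻¹ + c⁻¹ * cylIntegral hα G) := by gcongr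
    _ = (2 + cylIntegral hα G) * c⁻¹ * ρ ^ m := by rw [mul_assoc 2, h4]; ring

lemma norm_modeOp_apply_le {α : ℝ} (hα : 0 ≤ α) {m : ℕ} (hm : 4 ≤ m) (k : ℕ) {g G : C(Cyl, ℝ)}
    (hG : ∀ x, |g x| ^ (3 / 2 : ℝ) ≤ G x) :
    ‖modeOp hα hm k g‖ ≤ (2 + cylIntegral hα G) * (m : ℝ) ^ (-(4 / 3) : ℝ) := by
  have hm0 : (0 : ℝ) < m := by norm_cast; omega
  have hG0 : 0 ≤ cylIntegral hα G :=
    cylIntegral_nonneg hα fun x => (Real.rpow_nonneg (abs_nonneg _) _).trans (hG x)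
  rw [ContinuousMap.norm_le _ (by positivity)]
  intro x
  rw [modeOp_apply, norm_mul]
  refine (mul_le_of_le_one_right (norm_nonneg _) (abs_sin_le_one _)).trans ?_
  rcases x.1.2.1.eq_or_lt with h0 | h0
  · rw [← h0, radSol_zero (by omega), norm_zero]; positivity
  have := abs_radSol_le_of_radInt (m := m) (h := modeSrc α k (cylExt g)) (j := 0)
    (A := (2 + cylIntegral hα G) * (m : ℝ) ^ (-(1 / 3) : ℝ)) (by positivity) (by omega)
    (fun ρ hρ => abs_radInt_modeSrc_le hα (by omega) k hG hρ) ⟨h0, x.1.2.2⟩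
  rw [radSol, norm_mul, norm_pow, Real.norm_of_nonneg h0.le]
  refine this.trans_eq ?_
  rw [pow_zero, Nat.cast_zero, sub_zero, mul_one, mul_div_assoc, ← Real.rpow_sub_one hm0.ne']
  norm_num

lemma norm_solOp_powMap_le {α : ℝ} (hα : 0 ≤ α) {n : ℕ} (hn : 4 ≤ n) {p : ℝ} (hp : 1 < p)
    (hp2 : p ≤ 2) {u : C(Cyl, ℝ)} (hu : cylIntegral hα (powAbs p hp u) = 1) :
    ‖solOp hα hn (powMap p hp u)‖ ≤
      ∑' i : ℕ, (3 + cylIntegral hα 1) * ((i : ℝ) + 1) ^ (-(4 / 3) : ℝ) := by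
  have hG : ∀ x, |powMap p hp u x| ^ (3 / 2 : ℝ) ≤ (1 + powAbs p hp u) x := by
    intro x
    rw [powMap_apply, abs_signedPow hp, ← Real.rpow_mul (abs_nonneg _), ContinuousMap.add_apply,
      powAbs_apply, ContinuousMap.one_apply]
    rcases le_total |u x| 1 with h | h
    · have := Real.rpow_le_one (abs_nonneg (u x)) h (by linarith : 0 ≤ p * (3 / 2))
      have := Real.rpow_nonneg (abs_nonneg (u x)) (p + 1)
      linarith
    · have := Real.rpow_le_rpow_of_exponent_le h (by linarith : p * (3 / 2) ≤ p + 1)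
      linarith
  have h1 : 0 ≤ cylIntegral hα 1 := cylIntegral_nonneg hα zero_le_one
  have h0 := hasSum_modeOp_apply hα hn (powMap p hp u)
  have hs : Summable fun i : ℕ => (3 + cylIntegral hα 1) * ((i : ℝ) + 1) ^ (-(4 / 3) : ℝ) :=
    (summable_succ_rpow (by norm_num)).mul_left _
  rw [← h0.tsum_eq]
  refine tsum_of_norm_bounded hs.hasSum fun i => ?_
  refine (norm_modeOp_apply_le hα _ _ hG).trans ?_
  rw [map_add, hu]
  calc _ = (3 + cylIntegral hα 1) * ((n * (2 * i + 1) : ℕ) : ℝ) ^ (-(4 / 3) : ℝ) := by ring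
    _ ≤ _ := mul_le_mul_of_nonneg_left (mul_odd_rpow_le hn i (by norm_num)) (by positivity)

lemma radSol_pos {m : ℕ} {h : ℝ → ℝ} (hh : Continuous h) (hpos : ∀ s ∈ Set.Ioo (0 : ℝ) 1, 0 < h s)
    {r : ℝ} (hr : r ∈ Set.Ioo (0 : ℝ) 1) : 0 < radSol m h r := by
  refine mul_pos (pow_pos hr.1 _) (intervalIntegral.intervalIntegral_pos_of_pos_on
    (intervalIntegrable_radInt_div hh hr.1 one_pos) (fun ρ hρ => ?_) hr.2)
  have hρ0 : 0 < ρ := hr.1.trans hρ.1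
  refine div_pos (intervalIntegral.intervalIntegral_pos_of_pos_on
    ((by fun_prop : Continuous _).intervalIntegrable _ _) (fun s hs => ?_) hρ0) (by positivity)
  exact mul_pos (pow_pos hs.1 _) (hpos s ⟨hs.1, hs.2.trans hρ.2⟩)

/-- The function `(s, ψ) ↦ sin ψ` on the cylinder. -/
def cylSin : C(Cyl, ℝ) := ⟨fun x => sin x.2, by fun_prop⟩

lemma cylIntegral_cylSin_pos {α : ℝ} (hα : 0 ≤ α) {n : ℕ} (hn : 4 ≤ n) {p : ℝ} (hp : 1 < p) :
    0 < cylIntegral hα (powMap p hp cylSin * solOp hα hn (powMap p hp cylSin)) := by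
  set w := powMap p hp cylSin
  have hsum := hasSum_cylIntegral_mul_modeOp hα hn w w
  have hnn := fun i : ℕ =>
    cylIntegral_mul_modeOp_nonneg hα (four_le_mul_odd hn i) (2 * i + 1) w
  refine lt_of_lt_of_le ?_ (le_hasSum hsum 0 fun i _ => hnn i)
  refine (hnn 0).lt_of_ne' fun h0 => ?_
  have h1 := DFunLike.congr_fun (modeOp_eq_zero hα (four_le_mul_odd hn 0) _ h0)
    (⟨1 / 2, by norm_num⟩, ⟨π / 2, by constructor <;> linarith [pi_pos]⟩)
  rw [modeOp_apply] at h1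
  have hκ : ∀ s, sinCoef 1 (cylExt w s) = π⁻¹ * ∫ ψ in (0 : ℝ)..2 * π, |sin ψ| ^ (p + 1) := by
    intro s
    rw [sinCoef]
    congr 1
    refine intervalIntegral.integral_congr fun ψ hψ => ?_
    rw [Set.uIcc_of_le two_pi_pos.le] at hψ
    simp only [cylExt, Set.projIcc_of_mem _ hψ]
    change signedPow p (sin ψ) * sin ((1 : ℕ) * ψ) = _
    rw [Nat.cast_one, one_mul, signedPow_mul_self hp]
  have hκ0 : 0 < π⁻¹ * ∫ ψ in (0 : ℝ)..2 * π, |sin ψ| ^ (p + 1) := by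
    refine mul_pos (inv_pos.2 pi_pos) ?_
    have hc : Continuous fun ψ : ℝ => |sin ψ| ^ (p + 1) :=
      continuous_sin.abs.rpow_const fun _ => Or.inr (by linarith)
    refine intervalIntegral.integral_pos two_pi_pos hc.continuousOn (fun ψ _ => by positivity)
      ⟨π / 2, by constructor <;> linarith [pi_pos], ?_⟩
    simp
  have h2 := radSol_pos (m := n * (2 * 0 + 1)) (continuous_modeSrc hα 1 (continuous_cylExt w))
    (fun s hs => by
      rw [modeSrc, hκ]
      exact mul_pos (Real.rpow_pos_of_pos hs.1 _) hκ0) (r := 1 / 2) (by norm_num)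
  simp at h1 h2
  linarith

theorem exists_cyl_eigenfunction {α : ℝ} (hα : 0 ≤ α) {n : ℕ} (hn : 4 ≤ n) {p : ℝ} (hp : 1 < p)
    (hp2 : p ≤ 2) : ∃ (r : ℝ) (u : C(Cyl, ℝ)), 0 < r ∧ u ≠ 0 ∧
      solOp hα hn (powMap p hp u) = r • u := by
  refine exists_nonlinear_eigenfunction (L := cylIntegral hα) (fun a ha => cylIntegral_nonneg hα ha)
    (fun a b => ?_) (fun a => ?_) (fun a ha => ?_) (isCompactOperator_solOp hα hn)
    ⟨_, fun u hu => norm_solOp_powMap_le hα hn hp hp2 hu⟩ ⟨_, cylIntegral_cylSin_pos hα hn hp⟩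
  · rw [← (hasSum_cylIntegral_mul_modeOp hα hn a b).tsum_eq,
      ← (hasSum_cylIntegral_mul_modeOp hα hn b a).tsum_eq]
    simp only [cylIntegral_mul_modeOp_comm hα _ _ a b]
  · exact (hasSum_cylIntegral_mul_modeOp hα hn a a).nonneg
      fun i => cylIntegral_mul_modeOp_nonneg hα _ _ a
  · have h := hasSum_cylIntegral_mul_modeOp hα hn a a
    rw [ha, hasSum_zero_iff_of_nonneg fun i => cylIntegral_mul_modeOp_nonneg hα _ _ a] at h
    rw [← (hasSum_modeOp_apply hα hn a).tsum_eq]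
    simp only [fun i : ℕ => modeOp_eq_zero hα (four_le_mul_odd hn i) _ (congrFun h i), tsum_zero]

section

variable {φ : ℝ → ℝ}

lemma periodic_of_antiperiodic_pi (h : ∀ x, φ (x + π) = -φ x) : Function.Periodic φ (2 * π) := by
  intro x
  rw [two_mul, ← add_assoc, h, h, neg_neg]

lemma integral_shift_of_periodic (h : Function.Periodic φ (2 * π)) (t : ℝ) :
    ∫ x in (0 : ℝ)..2 * π, φ (x + t) = ∫ x in (0 : ℝ)..2 * π, φ x := by
  rw [intervalIntegral.integral_comp_add_right, zero_add, add_comm (2 * π),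
    h.intervalIntegral_add_eq t 0, zero_add]

lemma integral_eq_zero_of_odd (h : Function.Periodic φ (2 * π)) (hodd : ∀ x, φ (-x) = -φ x) :
    ∫ x in (0 : ℝ)..2 * π, φ x = 0 := by
  have h1 : ∫ x in (0 : ℝ)..2 * π, φ (2 * π - x) = ∫ x in (0 : ℝ)..2 * π, φ x := by
    rw [intervalIntegral.integral_comp_sub_left, sub_self, sub_zero]
  have h2 : ∀ x, φ (2 * π - x) = -φ x := fun x => by rw [sub_eq_neg_add, h, hodd]
  simp only [h2, intervalIntegral.integral_neg] at h1
  linarith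

lemma sin_nat_mul_add_two_pi (k : ℕ) (x : ℝ) : sin (k * (x + 2 * π)) = sin (k * x) := by
  rw [mul_add, sin_add_nat_mul_two_pi]

lemma cos_nat_mul_add_two_pi (k : ℕ) (x : ℝ) : cos (k * (x + 2 * π)) = cos (k * x) := by
  rw [mul_add, cos_add_nat_mul_two_pi]

lemma sinCoef_even_eq_zero (h : ∀ x, φ (x + π) = -φ x) (i : ℕ) : sinCoef (2 * i) φ = 0 := by
  have hper := periodic_of_antiperiodic_pi h
  have h1 := integral_shift_of_periodic (φ := fun x => φ x * sin ((2 * i : ℕ) * x))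
    (fun x => by simp only [hper x, sin_nat_mul_add_two_pi]) π
  have h2 : ∀ x, sin ((2 * i : ℕ) * (x + π)) = sin ((2 * i : ℕ) * x) := fun x => by
    rw [mul_add, show ((2 * i : ℕ) : ℝ) * π = i * (2 * π) by push_cast; ring,
      sin_add_nat_mul_two_pi]
  simp only [h, h2, neg_mul, intervalIntegral.integral_neg] at h1
  rw [sinCoef, show ∫ ψ in (0 : ℝ)..2 * π, φ ψ * sin ((2 * i : ℕ) * ψ) = 0 by linarith, mul_zero]

lemma sinCoef_shift (h : Function.Periodic φ (2 * π)) {k : ℕ} (hk : k ≠ 0) :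
    sinCoef k (fun x => φ (x + π / k)) = -sinCoef k φ := by
  have h1 := integral_shift_of_periodic (φ := fun x => φ x * sin (k * x))
    (fun x => by simp only [h x, sin_nat_mul_add_two_pi]) (π / k)
  have h2 : ∀ x, sin (k * (x + π / k)) = -sin (k * x) := fun x => by
    rw [mul_add, mul_div_cancel₀ _ (Nat.cast_ne_zero.2 hk), sin_add_pi]
  simp only [h2, mul_neg, intervalIntegral.integral_neg] at h1
  rw [sinCoef, sinCoef, ← h1, mul_neg, neg_neg]

lemma sinCoef_shift_neg (h : Function.Periodic φ (2 * π)) {k : ℕ} (hk : k ≠ 0) :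
    sinCoef k (fun x => φ (x - π / k)) = -sinCoef k φ := by
  have := sinCoef_shift (φ := fun x => φ (x - π / k))
    (fun x => by simp only [add_sub_right_comm, h _]) hk
  simp only [add_sub_cancel_right] at this
  linarith

lemma abs_sinCoef_le_of_diff (hφ : Continuous φ) (h : Function.Periodic φ (2 * π)) {k : ℕ}
    (hk : k ≠ 0) {D : ℝ} (hD : ∀ x, |φ (x + π / k) - φ x| ≤ D) : |sinCoef k φ| ≤ D := by
  have h1 := sinCoef_add k (f := fun x => φ (x + π / k)) (g := fun x => (-1) * φ x)
    (by fun_prop) (by fun_prop)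
  rw [sinCoef_shift h hk, sinCoef_const_mul] at h1
  have h2 := abs_sinCoef_le k (g := fun x => φ (x + π / k) + (-1) * φ x) (M := D)
    fun x _ => by simpa [sub_eq_add_neg] using hD x
  rw [h1, show -sinCoef k φ + -1 * sinCoef k φ = -(2 * sinCoef k φ) by ring, abs_neg, abs_mul,
    abs_two] at h2
  linarith

lemma abs_sinCoef_le_of_second_diff (hφ : Continuous φ) (h : Function.Periodic φ (2 * π)) {k : ℕ}
    (hk : k ≠ 0) {D : ℝ} (hD : ∀ x, |φ (x + π / k) + φ (x - π / k) - 2 * φ x| ≤ D) :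
    |sinCoef k φ| ≤ D := by
  have h1 := sinCoef_add k (f := fun x => φ (x + π / k)) (g := fun x => φ (x - π / k))
    (by fun_prop) (by fun_prop)
  have h2 := sinCoef_add k (f := fun x => φ (x + π / k) + φ (x - π / k))
    (g := fun x => (-2) * φ x) (by fun_prop) (by fun_prop)
  rw [h1, sinCoef_shift h hk, sinCoef_shift_neg h hk, sinCoef_const_mul] at h2
  have h3 := abs_sinCoef_le k (g := fun x => φ (x + π / k) + φ (x - π / k) + (-2) * φ x) (M := D)
    fun x _ => by simpa [sub_eq_add_neg] using hD x
  rw [h2, show -sinCoef k φ + -sinCoef k φ + -2 * sinCoef k φ = -(4 * sinCoef k φ) by ring,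
    abs_neg, abs_mul, abs_of_pos (by norm_num : (0 : ℝ) < 4)] at h3
  have := abs_nonneg (sinCoef k φ)
  linarith

lemma fourierCoeff_lift_of_odd (hφ : Continuous φ) (h : Function.Periodic φ (2 * π))
    (hodd : ∀ x, φ (-x) = -φ x) [Fact (0 < 2 * π)] {F : AddCircle (2 * π) → ℂ}
    (hF : ∀ x : ℝ, F x = φ x) (k : ℕ) :
    fourierCoeff F k = -(Complex.I / 2) * sinCoef k φ ∧
      fourierCoeff F (-k) = Complex.I / 2 * sinCoef k φ := by
  have hcos : ∫ x in (0 : ℝ)..2 * π, φ x * cos (k * x) = 0 :=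
    integral_eq_zero_of_odd (φ := fun x => φ x * cos (k * x))
      (fun x => by simp only [h x, cos_nat_mul_add_two_pi])
      (fun x => by simp only [hodd x, mul_neg, cos_neg, neg_mul])
  have key : ∀ ε : ℝ, ε = 1 ∨ ε = -1 → ∀ n : ℤ, (n : ℝ) = -ε * k →
      fourierCoeff F n = ε * (Complex.I / 2) * sinCoef k φ := by
    intro ε hε n hn
    rw [fourierCoeff_eq_intervalIntegral F n 0, zero_add]
    have h1 : ∀ x : ℝ, fourier (-n) (x : AddCircle (2 * π)) • F x =
        ((φ x * cos (k * x) : ℝ) : ℂ) + (ε * Complex.I) * ((φ x * sin (k * x) : ℝ) : ℂ) := by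
      intro x
      have e1 : (2 * π * Complex.I * (-n : ℤ) * x / (2 * π : ℝ) : ℂ) =
          ((ε * (k * x) : ℝ) : ℂ) * Complex.I := by
        have hn' : ((-n : ℤ) : ℂ) = ((ε * k : ℝ) : ℂ) := by
          rw [← Complex.ofReal_intCast]; congr 1; push_cast; rw [hn]; ring
        have : (π : ℂ) ≠ 0 := by exact_mod_cast pi_ne_zero
        rw [hn']; push_cast; field_simp
      rw [fourier_coe_apply, e1, Complex.exp_mul_I, ← Complex.ofReal_cos, ← Complex.ofReal_sin, hF,
        smul_eq_mul]
      rcases hε with rfl | rfl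
      · push_cast; simp; ring
      · simp; ring
    simp only [h1]
    rw [intervalIntegral.integral_add
      ((by fun_prop : Continuous _).intervalIntegrable _ _)
      ((by fun_prop : Continuous _).intervalIntegrable _ _), intervalIntegral.integral_const_mul,
      intervalIntegral.integral_ofReal, intervalIntegral.integral_ofReal, hcos, sinCoef]
    have : (π : ℂ) ≠ 0 := by exact_mod_cast pi_ne_zero
    rw [Complex.real_smul]
    push_cast
    field_simp
    ring
  constructor
  · rw [key (-1) (Or.inr rfl) k (by push_cast; ring)]; push_cast; ring
  · rw [key 1 (Or.inl rfl) (-k) (by push_cast; ring)]; push_cast; ring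

theorem hasSum_sinCoef (hφ : Continuous φ) (h : ∀ x, φ (x + π) = -φ x)
    (hodd : ∀ x, φ (-x) = -φ x) (hs : Summable fun i : ℕ => sinCoef (2 * i + 1) φ) (x : ℝ) :
    HasSum (fun i : ℕ => sinCoef (2 * i + 1) φ * sin ((2 * i + 1 : ℕ) * x)) (φ x) := by
  have : Fact (0 < 2 * π) := ⟨two_pi_pos⟩
  have hper := periodic_of_antiperiodic_pi h
  have hinj : Function.Injective fun i : ℕ => 2 * i + 1 := fun i j hij => by
    simpa using hij
  have hrange : ∀ k : ℕ, k ∉ Set.range (fun i : ℕ => 2 * i + 1) → sinCoef k φ = 0 := by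
    intro k hk
    rcases Nat.even_or_odd' k with ⟨c, rfl | rfl⟩
    · exact sinCoef_even_eq_zero h c
    · exact absurd ⟨c, rfl⟩ hk
  have hs' : Summable fun k : ℕ => sinCoef k φ := (hinj.summable_iff hrange).1 hs
  set ψ : ℝ → ℂ := fun x => φ x with hψ
  have hψper : Function.Periodic ψ (2 * π) := fun x => by simp only [hψ, hper x]
  let F : C(AddCircle (2 * π), ℂ) :=
    ⟨hψper.lift, (Complex.continuous_ofReal.comp hφ).quotient_lift _⟩
  have hF : ∀ x : ℝ, F x = φ x := fun x => hψper.lift_coe x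
  have hc := fourierCoeff_lift_of_odd hφ hper hodd hF
  have hsum : Summable (fourierCoeff F) := by
    have h0 : Summable fun k : ℕ => (sinCoef k φ : ℂ) := Complex.summable_ofReal.2 hs'
    refine Summable.of_nat_of_neg ?_ ?_
    · simp only [(hc _).1]; exact h0.mul_left _
    · simp only [(hc _).2]; exact h0.mul_left _
  have h1 := (has_pointwise_sum_fourier_series_of_summable hsum (x : AddCircle (2 * π))).nat_add_neg
  have hc0 : fourierCoeff F 0 = 0 := by
    have := (hc 0).1
    have h00 : sinCoef 0 φ = 0 := sinCoef_even_eq_zero h 0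
    simpa [h00] using this
  rw [hc0, zero_smul, add_zero, hF] at h1
  have h2 : ∀ k : ℕ, fourierCoeff F k • fourier k (x : AddCircle (2 * π)) +
      fourierCoeff F (-k) • fourier (-k) (x : AddCircle (2 * π)) =
      ((sinCoef k φ * sin (k * x) : ℝ) : ℂ) := by
    intro k
    have : (π : ℂ) ≠ 0 := by exact_mod_cast pi_ne_zero
    have e1 : (2 * π * Complex.I * (k : ℤ) * x / (2 * π : ℝ) : ℂ) = (k * x) * Complex.I := by
      push_cast; field_simp
    have e2 : (2 * π * Complex.I * (-k : ℤ) * x / (2 * π : ℝ) : ℂ) = -(k * x) * Complex.I := by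
      push_cast; field_simp
    rw [(hc k).1, (hc k).2, fourier_coe_apply, fourier_coe_apply, e1, e2, smul_eq_mul, smul_eq_mul]
    push_cast
    rw [Complex.sin]
    ring
  simp only [h2] at h1
  have h3 : HasSum (fun k : ℕ => sinCoef k φ * sin (k * x)) (φ x) := Complex.hasSum_ofReal.1 h1
  exact (hinj.hasSum_iff fun k hk => by rw [hrange k hk, zero_mul]).2 h3

end

lemma hasDerivAt_signedPow {p : ℝ} (hp : 1 < p) (x : ℝ) :
    HasDerivAt (signedPow p) (p * |x| ^ (p - 1)) x := by
  rcases eq_or_ne x 0 with rfl | hx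
  · rw [hasDerivAt_iff_tendsto_slope_zero]
    have h1 : Tendsto (fun t : ℝ => |t| ^ (p - 1)) (𝓝[≠] 0) (𝓝 (p * |(0 : ℝ)| ^ (p - 1))) := by
      have h2 : Continuous fun t : ℝ => |t| ^ (p - 1) :=
        continuous_abs.rpow_const fun _ => Or.inr (by linarith)
      have h3 := (h2.tendsto 0).mono_left (nhdsWithin_le_nhds (s := {0}ᶜ))
      rw [abs_zero, Real.zero_rpow (by linarith)] at h3 ⊢
      rwa [mul_zero]
    refine h1.congr' ?_
    filter_upwards [self_mem_nhdsWithin] with t ht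
    have ht : t ≠ 0 := ht
    simp [signedPow]
    field_simp
  · have h1 := ((hasDerivAt_abs hx).rpow_const (p := p - 1) (Or.inl (abs_ne_zero.2 hx))).mul
      (hasDerivAt_id x)
    refine h1.congr_deriv ?_
    have h2 : |x| ^ (p - 1) = |x| ^ (p - 1 - 1) * |x| := by
      rw [← Real.rpow_add_one (abs_ne_zero.2 hx), sub_add_cancel]
    have h3 : (SignType.sign x : ℝ) * x = |x| := sign_mul_self x
    simp only [id]
    rw [h2, ← h3]
    ring

lemma abs_signedPow_sub_le {p S : ℝ} (hp : 1 < p) {x y : ℝ} (hx : |x| ≤ S) (hy : |y| ≤ S) :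
    |signedPow p x - signedPow p y| ≤ p * S ^ (p - 1) * |x - y| := by
  have h := (convex_Icc (-S) S).norm_image_sub_le_of_norm_hasDerivWithin_le
    (f := signedPow p) (f' := fun t => p * |t| ^ (p - 1)) (C := p * S ^ (p - 1))
    (fun t _ => (hasDerivAt_signedPow hp t).hasDerivWithinAt) (fun t ht => ?_)
    (abs_le.1 hy) (abs_le.1 hx)
  · exact h
  · rw [Real.norm_of_nonneg (by positivity)]
    gcongr
    exact abs_le.2 ht

lemma abs_rpow_sub_rpow_le {q : ℝ} (hq : 0 ≤ q) (hq1 : q ≤ 1) (x y : ℝ) :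
    |(|x| ^ q - |y| ^ q)| ≤ |x - y| ^ q := by
  have h : ∀ x y : ℝ, |x| ^ q ≤ |y| ^ q + |x - y| ^ q := fun x y =>
    (Real.rpow_le_rpow (abs_nonneg x)
      (by simpa using abs_add_le y (x - y)) hq).trans
      (Real.rpow_add_le_add_rpow (abs_nonneg _) (abs_nonneg _) hq hq1)
  rw [abs_le]
  constructor
  · have := h y x
    rw [abs_sub_comm] at this
    linarith
  · have := h x y
    linarith

lemma abs_signedPow_taylor_le {p : ℝ} (hp : 1 < p) (hp2 : p ≤ 2) (x y : ℝ) :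
    |signedPow p x - signedPow p y - p * |y| ^ (p - 1) * (x - y)| ≤ p * |x - y| ^ p := by
  have h := (convex_uIcc y x).norm_image_sub_le_of_norm_hasDerivWithin_le
    (f := fun t => signedPow p t - p * |y| ^ (p - 1) * t)
    (f' := fun t => p * |t| ^ (p - 1) - p * |y| ^ (p - 1)) (C := p * |x - y| ^ (p - 1))
    (fun t _ => ((hasDerivAt_signedPow hp t).sub
      ((hasDerivAt_id t).const_mul (p * |y| ^ (p - 1)) |>.congr_deriv
        (mul_one _))).hasDerivWithinAt) (fun t ht => ?_)
    Set.left_mem_uIcc Set.right_mem_uIcc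
  · have e : p * |x - y| ^ (p - 1) * |x - y| = p * |x - y| ^ p := by
      rcases eq_or_ne x y with rfl | hxy
      · simp [Real.zero_rpow (by linarith : p ≠ 0)]
      · rw [mul_assoc, ← Real.rpow_add_one (abs_ne_zero.2 (sub_ne_zero.2 hxy)), sub_add_cancel]
    rw [Real.norm_eq_abs, Real.norm_eq_abs, e] at h
    refine (le_of_eq ?_).trans h
    congr 1; ring
  · rw [← mul_sub, norm_mul, Real.norm_of_nonneg (by linarith : 0 ≤ p)]
    gcongr
    exact (abs_rpow_sub_rpow_le (by linarith) (by linarith) t y).trans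
      (Real.rpow_le_rpow (abs_nonneg _) (Set.abs_sub_left_of_mem_uIcc ht) (by linarith))

lemma abs_signedPow_second_diff_le {p S : ℝ} (hp : 1 < p) (hp2 : p ≤ 2) {a b y : ℝ}
    (hy : |y| ≤ S) :
    |signedPow p a + signedPow p b - 2 * signedPow p y| ≤
      p * |a - y| ^ p + p * |b - y| ^ p + p * S ^ (p - 1) * |a + b - 2 * y| := by
  have e : signedPow p a + signedPow p b - 2 * signedPow p y =
      (signedPow p a - signedPow p y - p * |y| ^ (p - 1) * (a - y)) +
      (signedPow p b - signedPow p y - p * |y| ^ (p - 1) * (b - y)) +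
      p * |y| ^ (p - 1) * (a + b - 2 * y) := by ring
  have h3 : |p * |y| ^ (p - 1) * (a + b - 2 * y)| ≤ p * S ^ (p - 1) * |a + b - 2 * y| := by
    rw [abs_mul, abs_of_nonneg (by positivity)]
    gcongr
  rw [e]
  refine (abs_add_three _ _ _).trans ?_
  gcongr
  · exact abs_signedPow_taylor_le hp hp2 a y
  · exact abs_signedPow_taylor_le hp hp2 b y

lemma abs_sin_add_sub_sin_le_sqrt (a x : ℝ) : |sin (a + x) - sin a| ≤ 2 * |x| ^ (1 / 2 : ℝ) := by
  rcases le_total |x| 1 with h | h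
  · have h1 := abs_sin_sub_sin_le (a + x) a
    rw [add_sub_cancel_left] at h1
    have h2 := Real.rpow_le_rpow_of_exponent_ge' (abs_nonneg x) h (z := 1 / 2) (y := 1)
      (by norm_num) (by norm_num)
    rw [Real.rpow_one] at h2
    linarith [abs_nonneg x]
  · have h1 : |sin (a + x) - sin a| ≤ 2 := by
      rw [abs_le]; constructor <;>
      linarith [sin_le_one (a + x), neg_one_le_sin (a + x), sin_le_one a, neg_one_le_sin a]
    have := Real.one_le_rpow h (z := 1 / 2) (by norm_num)
    linarith

lemma abs_sin_second_diff_le (a x : ℝ) :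
    |sin (a + x) + sin (a - x) - 2 * sin a| ≤ 4 * |x| ^ (5 / 4 : ℝ) := by
  rw [show sin (a + x) + sin (a - x) - 2 * sin a = 2 * sin a * (cos x - 1) by
    rw [sin_add, sin_sub]; ring, abs_mul, abs_mul, abs_two]
  have hs := abs_sin_le_one a
  have hc : |cos x - 1| ≤ 2 * |x| ^ (5 / 4 : ℝ) := by
    rw [abs_sub_comm, abs_of_nonneg (by linarith [cos_le_one x])]
    rcases le_total |x| 1 with h | h
    · have h1 := one_sub_sq_div_two_le_cos (x := x)
      have h2 := Real.rpow_le_rpow_of_exponent_ge' (abs_nonneg x) h (z := 5 / 4) (y := 2)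
        (by norm_num) (by norm_num)
      rw [Real.rpow_two, sq_abs] at h2
      nlinarith [sq_nonneg x]
    · have := Real.one_le_rpow h (z := 5 / 4) (by norm_num)
      linarith [neg_one_le_cos x]
  nlinarith [abs_nonneg (cos x - 1), abs_nonneg (sin a)]

/-- The sum `∑ (i + 1)⁻ᵠ`. -/
def succZeta (q : ℝ) : ℝ := ∑' i : ℕ, ((i : ℝ) + 1) ^ (-q)

lemma succZeta_nonneg (q : ℝ) : 0 ≤ succZeta q := tsum_nonneg fun _ => by positivity

lemma abs_le_of_hasSum_mul {R T : ℕ → ℝ} {C c q e h a : ℝ} (hC : 0 ≤ C) (hc : 0 ≤ c) (he : 0 ≤ e)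
    (hqe : 1 < q - e) (hR : ∀ i : ℕ, |R i| ≤ C * ((i : ℝ) + 1) ^ (-q))
    (hT : ∀ i : ℕ, |T i| ≤ c * |((2 * i + 1 : ℕ) : ℝ) * h| ^ e)
    (ha : HasSum (fun i => R i * T i) a) :
    |a| ≤ C * c * 2 ^ e * succZeta (q - e) * |h| ^ e := by
  have hs : HasSum (fun i : ℕ => C * c * 2 ^ e * |h| ^ e * ((i : ℝ) + 1) ^ (-(q - e)))
      (C * c * 2 ^ e * |h| ^ e * succZeta (q - e)) := (summable_succ_rpow hqe).hasSum.mul_left _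
  refine (ha.norm_le_of_bounded hs fun i => ?_).trans_eq (by ring)
  have h1 : |((2 * i + 1 : ℕ) : ℝ) * h| ^ e ≤ 2 ^ e * ((i : ℝ) + 1) ^ e * |h| ^ e := by
    rw [← Real.mul_rpow (by norm_num) (by positivity), ← Real.mul_rpow (by positivity)
      (abs_nonneg _), abs_mul, abs_of_nonneg (by positivity : (0 : ℝ) ≤ (2 * i + 1 : ℕ))]
    gcongr
    push_cast; linarith
  rw [norm_mul, Real.norm_eq_abs, Real.norm_eq_abs]
  calc |R i| * |T i| ≤ (C * ((i : ℝ) + 1) ^ (-q)) *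
        (c * (2 ^ e * ((i : ℝ) + 1) ^ e * |h| ^ e)) :=
        mul_le_mul (hR i) ((hT i).trans (mul_le_mul_of_nonneg_left h1 hc)) (abs_nonneg _)
          (by positivity)
    _ = _ := by
        rw [show -(q - e) = -q + e by ring, Real.rpow_add (by positivity)]; ring

/-- The odd sine series with coefficients `R`. -/
def oddSeries (R : ℕ → ℝ) (ψ : ℝ) : ℝ := ∑' i, R i * sin ((2 * i + 1 : ℕ) * ψ)

section

variable {R : ℕ → ℝ} {C q : ℝ}

lemma oddSeries_neg (ψ : ℝ) : oddSeries R (-ψ) = -oddSeries R ψ := by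
  simp [oddSeries, tsum_neg]

lemma oddSeries_add_pi (ψ : ℝ) : oddSeries R (ψ + π) = -oddSeries R ψ := by
  rw [oddSeries, oddSeries, ← tsum_neg]
  refine tsum_congr fun i => ?_
  rw [mul_add, show ((2 * i + 1 : ℕ) : ℝ) * π = i * (2 * π) + π by push_cast; ring, ← add_assoc,
    sin_add_pi, sin_add_nat_mul_two_pi, mul_neg]

lemma abs_mul_sin_le (hR : ∀ i : ℕ, |R i| ≤ C * ((i : ℝ) + 1) ^ (-q)) (i : ℕ) (ψ : ℝ) :
    ‖R i * sin ((2 * i + 1 : ℕ) * ψ)‖ ≤ C * ((i : ℝ) + 1) ^ (-q) := by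
  rw [norm_mul]
  exact (mul_le_of_le_one_right (norm_nonneg _) (abs_sin_le_one _)).trans (hR i)

lemma hasSum_oddSeries (hq : 1 < q) (hR : ∀ i : ℕ, |R i| ≤ C * ((i : ℝ) + 1) ^ (-q)) (ψ : ℝ) :
    HasSum (fun i => R i * sin ((2 * i + 1 : ℕ) * ψ)) (oddSeries R ψ) :=
  (Summable.of_norm_bounded ((summable_succ_rpow hq).mul_left C)
    fun i => abs_mul_sin_le hR i ψ).hasSum

lemma continuous_oddSeries (hq : 1 < q) (hR : ∀ i : ℕ, |R i| ≤ C * ((i : ℝ) + 1) ^ (-q)) :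
    Continuous (oddSeries R) :=
  continuous_tsum (fun i => by fun_prop) ((summable_succ_rpow hq).mul_left C)
    fun i ψ => abs_mul_sin_le hR i ψ

lemma abs_oddSeries_le (hq : 1 < q) (hR : ∀ i : ℕ, |R i| ≤ C * ((i : ℝ) + 1) ^ (-q)) (ψ : ℝ) :
    |oddSeries R ψ| ≤ C * succZeta q :=
  (hasSum_oddSeries hq hR ψ).norm_le_of_bounded ((summable_succ_rpow hq).hasSum.mul_left C)
    fun i => abs_mul_sin_le hR i ψ

lemma abs_oddSeries_sub_le (hC : 0 ≤ C) (hq : 1 < q) {c e : ℝ} (hc : 0 ≤ c) (he : 0 ≤ e)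
    (hqe : 1 < q - e) (hsin : ∀ a x : ℝ, |sin (a + x) - sin a| ≤ c * |x| ^ e)
    (hR : ∀ i : ℕ, |R i| ≤ C * ((i : ℝ) + 1) ^ (-q)) (ψ h : ℝ) :
    |oddSeries R (ψ + h) - oddSeries R ψ| ≤ C * c * 2 ^ e * succZeta (q - e) * |h| ^ e := by
  refine abs_le_of_hasSum_mul hC hc he hqe hR (T := fun i : ℕ =>
    sin ((2 * i + 1 : ℕ) * ψ + (2 * i + 1 : ℕ) * h) - sin ((2 * i + 1 : ℕ) * ψ))
    (fun i => hsin _ _) ?_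
  simpa only [mul_sub, mul_add] using
    (hasSum_oddSeries hq hR (ψ + h)).sub (hasSum_oddSeries hq hR ψ)

lemma abs_oddSeries_second_diff_le (hC : 0 ≤ C) (hq : 9 / 4 < q)
    (hR : ∀ i : ℕ, |R i| ≤ C * ((i : ℝ) + 1) ^ (-q)) (ψ h : ℝ) :
    |oddSeries R (ψ + h) + oddSeries R (ψ - h) - 2 * oddSeries R ψ| ≤
      C * 4 * 2 ^ (5 / 4 : ℝ) * succZeta (q - 5 / 4) * |h| ^ (5 / 4 : ℝ) := by
  have hq1 : 1 < q := by linarith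
  refine abs_le_of_hasSum_mul hC (by norm_num) (by norm_num) (by linarith) hR (T := fun i : ℕ =>
    sin ((2 * i + 1 : ℕ) * ψ + (2 * i + 1 : ℕ) * h) +
    sin ((2 * i + 1 : ℕ) * ψ - (2 * i + 1 : ℕ) * h) - 2 * sin ((2 * i + 1 : ℕ) * ψ))
    (fun i => abs_sin_second_diff_le _ _) ?_
  have := ((hasSum_oddSeries hq1 hR (ψ + h)).add (hasSum_oddSeries hq1 hR (ψ - h))).sub
    ((hasSum_oddSeries hq1 hR ψ).mul_left 2)
  refine this.congr_fun fun i => ?_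
  rw [mul_add _ ψ, mul_sub _ ψ]
  ring

end

lemma continuous_signedPow_oddSeries {R : ℕ → ℝ} {C q p : ℝ} (hp : 1 < p) (hq : 1 < q)
    (hR : ∀ i : ℕ, |R i| ≤ C * ((i : ℝ) + 1) ^ (-q)) :
    Continuous fun ψ => signedPow p (oddSeries R ψ) :=
  (continuous_signedPow hp).comp (continuous_oddSeries hq hR)

lemma signedPow_oddSeries_add_pi (p : ℝ) (R : ℕ → ℝ) (ψ : ℝ) :
    signedPow p (oddSeries R (ψ + π)) = -signedPow p (oddSeries R ψ) := by
  rw [oddSeries_add_pi, signedPow_neg]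

lemma pi_div_odd_rpow_le (i : ℕ) {e : ℝ} (he : 0 ≤ e) :
    |π / (2 * i + 1 : ℕ)| ^ e ≤ π ^ e * ((i : ℝ) + 1) ^ (-e) := by
  rw [abs_of_nonneg (by positivity), Real.rpow_neg (by positivity), ← div_eq_mul_inv,
    ← Real.div_rpow pi_pos.le (by positivity)]
  gcongr
  push_cast; linarith [(Nat.cast_nonneg i : (0 : ℝ) ≤ i)]

section

variable {p : ℝ} {R : ℕ → ℝ} {C q : ℝ}

lemma abs_sinCoef_signedPow_le_of_two (hp : 1 < p) (hC : 0 ≤ C)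
    (hR : ∀ i : ℕ, |R i| ≤ C * ((i : ℝ) + 1) ^ (-2 : ℝ)) (i : ℕ) :
    |sinCoef (2 * i + 1) fun ψ => signedPow p (oddSeries R ψ)| ≤
      p * (C * succZeta 2) ^ (p - 1) * (C * 2 * 2 ^ (1 / 2 : ℝ) * succZeta (2 - 1 / 2)) *
        π ^ (1 / 2 : ℝ) * ((i : ℝ) + 1) ^ (-(1 / 2) : ℝ) := by
  have hz := succZeta_nonneg
  refine abs_sinCoef_le_of_diff (continuous_signedPow_oddSeries hp one_lt_two hR)
    (periodic_of_antiperiodic_pi (signedPow_oddSeries_add_pi p R)) (by omega) fun x => ?_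
  refine (abs_signedPow_sub_le hp (abs_oddSeries_le one_lt_two hR _)
    (abs_oddSeries_le one_lt_two hR _)).trans ?_
  have h := abs_oddSeries_sub_le hC one_lt_two (by norm_num) (by norm_num) (by norm_num)
    abs_sin_add_sub_sin_le_sqrt hR x (π / (2 * i + 1 : ℕ))
  have h2 := pi_div_odd_rpow_le i (e := 1 / 2) (by norm_num)
  have hpos : 0 ≤ p * (C * succZeta 2) ^ (p - 1) :=
    mul_nonneg (by linarith) (Real.rpow_nonneg (mul_nonneg hC (hz _)) _)
  have hpos2 : 0 ≤ C * 2 * 2 ^ (1 / 2 : ℝ) * succZeta (2 - 1 / 2) :=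
    mul_nonneg (by positivity) (hz _)
  rw [mul_assoc (p * _ ^ _), mul_assoc (p * _ ^ _), mul_assoc (C * 2 * _ * _)]
  exact mul_le_mul_of_nonneg_left (h.trans (mul_le_mul_of_nonneg_left h2 hpos2)) hpos

lemma exists_sinCoef_signedPow_le (hp : 1 < p) (hp2 : p ≤ 5 / 4) (hC : 0 ≤ C) : ∃ D : ℝ, 0 ≤ D ∧
    ∀ R : ℕ → ℝ, (∀ i : ℕ, |R i| ≤ C * ((i : ℝ) + 1) ^ (-(5 / 2) : ℝ)) → ∀ i : ℕ,
      |sinCoef (2 * i + 1) fun ψ => signedPow p (oddSeries R ψ)| ≤ D * ((i : ℝ) + 1) ^ (-p) := by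
  have hz := succZeta_nonneg
  set S : ℝ := C * succZeta (5 / 2) with hS
  have hS0 : 0 ≤ S := mul_nonneg hC (hz _)
  set L : ℝ := C * 1 * 2 ^ (1 : ℝ) * succZeta (5 / 2 - 1) with hL
  have hL0 : 0 ≤ L := mul_nonneg (by positivity) (hz _)
  set K : ℝ := C * 4 * 2 ^ (5 / 4 : ℝ) * succZeta (5 / 2 - 5 / 4) with hK
  have hK0 : 0 ≤ K := mul_nonneg (by positivity) (hz _)
  have hp0 : 0 ≤ p := by linarith
  refine ⟨2 * (p * (L ^ p * π ^ p)) + p * S ^ (p - 1) * (K * π ^ (5 / 4 : ℝ)), by positivity,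
    fun R hR i => ?_⟩
  have hq : (1 : ℝ) < 5 / 2 := by norm_num
  set h : ℝ := π / (2 * i + 1 : ℕ) with hh
  refine abs_sinCoef_le_of_second_diff (continuous_signedPow_oddSeries hp hq hR)
    (periodic_of_antiperiodic_pi (signedPow_oddSeries_add_pi p R)) (by omega) fun x => ?_
  refine (abs_signedPow_second_diff_le hp (by linarith) (abs_oddSeries_le hq hR _)).trans ?_
  have hfirst : ∀ t : ℝ, |t| = |h| → |oddSeries R (x + t) - oddSeries R x| ^ p ≤
      L ^ p * π ^ p * ((i : ℝ) + 1) ^ (-p) := fun t ht => by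
    have h1 := abs_oddSeries_sub_le hC hq zero_le_one zero_le_one (by norm_num)
      (fun a x => by
        rw [one_mul, Real.rpow_one]
        simpa using abs_sin_sub_sin_le (a + x) a) hR x t
    rw [Real.rpow_one |t|, ht] at h1
    calc |oddSeries R (x + t) - oddSeries R x| ^ p ≤ (L * |h|) ^ p := by gcongr
      _ = L ^ p * |h| ^ p := Real.mul_rpow hL0 (abs_nonneg _)
      _ ≤ L ^ p * (π ^ p * ((i : ℝ) + 1) ^ (-p)) := by
        gcongr; exact pi_div_odd_rpow_le i hp0
      _ = _ := by ring
  have h1 := hfirst h rfl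
  have h2 := hfirst (-h) (abs_neg h)
  rw [← sub_eq_add_neg] at h2
  have h3 : |oddSeries R (x + h) + oddSeries R (x - h) - 2 * oddSeries R x| ≤
      K * π ^ (5 / 4 : ℝ) * ((i : ℝ) + 1) ^ (-p) := by
    refine (abs_oddSeries_second_diff_le hC (by norm_num) hR x h).trans ?_
    rw [mul_assoc K]
    refine mul_le_mul_of_nonneg_left ((pi_div_odd_rpow_le i (by norm_num)).trans ?_) hK0
    gcongr
    linarith [(Nat.cast_nonneg i : (0 : ℝ) ≤ i)]
  calc _ ≤ p * (L ^ p * π ^ p * ((i : ℝ) + 1) ^ (-p)) + p * (L ^ p * π ^ p * ((i : ℝ) + 1) ^ (-p))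
        + p * S ^ (p - 1) * (K * π ^ (5 / 4 : ℝ) * ((i : ℝ) + 1) ^ (-p)) := by
        gcongr
    _ = _ := by ring

end

lemma abs_radSol_le_succ_rpow {n : ℕ} (hn : 4 ≤ n) (i : ℕ) {h : ℝ → ℝ} {D e : ℝ} (hD : 0 ≤ D)
    (hh : ∀ s ∈ Set.Icc (0 : ℝ) 1, |h s| ≤ D * ((i : ℝ) + 1) ^ (-e)) {s : ℝ}
    (hs : s ∈ Set.Icc (0 : ℝ) 1) :
    |radSol (n * (2 * i + 1)) h s| ≤ 2 * D * s ^ 2 * ((i : ℝ) + 1) ^ (-(e + 2)) := by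
  have h1 := abs_radSol_le (B := D * ((i : ℝ) + 1) ^ (-e)) (by positivity) (d := 0)
    (four_le_mul_odd hn i) (by simpa using hh) hs
  refine h1.trans ?_
  have h2 := mul_odd_rpow_le hn i zero_le_two
  have hs2 : 0 ≤ s ^ (2 + 0) := pow_nonneg hs.1 _
  rw [Real.rpow_neg (by positivity), Real.rpow_two] at h2
  rw [neg_add, Real.rpow_add (by positivity), div_eq_mul_inv]
  calc _ ≤ 2 * (D * ((i : ℝ) + 1) ^ (-e)) * ((i : ℝ) + 1) ^ (-2 : ℝ) * s ^ (2 + 0) := by gcongr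
    _ = _ := by ring

lemma exists_cyl_fixed_point {α : ℝ} (hα : 0 ≤ α) {n : ℕ} (hn : 4 ≤ n) {p : ℝ} (hp : 1 < p)
    (hp2 : p ≤ 2) : ∃ w : C(Cyl, ℝ), w ≠ 0 ∧ solOp hα hn (powMap p hp w) = w := by
  obtain ⟨r, u, hr, hu, h⟩ := exists_cyl_eigenfunction hα hn hp hp2
  set c : ℝ := (r⁻¹) ^ (p - 1)⁻¹ with hc
  have hc0 : 0 < c := by positivity
  have hcp : c ^ p * r = c := by
    have h1 : c ^ (p - 1) = r⁻¹ := by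
      rw [hc, ← Real.rpow_mul (by positivity), inv_mul_cancel₀ (by linarith), Real.rpow_one]
    rw [show p = p - 1 + 1 by ring, Real.rpow_add_one hc0.ne', h1]
    field_simp
  refine ⟨c • u, smul_ne_zero hc0.ne' hu, ?_⟩
  rw [powMap_smul hp hc0.le, map_smul, h, smul_smul, hcp]

/-- Existence of a nontrivial solution in polar coordinates, as a series of separated modes. -/
theorem exists_profile {α : ℝ} (hα : 0 ≤ α) {n : ℕ} (hn : 4 ≤ n) {p : ℝ} (hp : 1 < p)
    (hp2 : p ≤ 5 / 4) : ∃ (h : ℕ → ℝ → ℝ) (D : ℝ), 0 ≤ D ∧ (∀ i, Continuous (h i)) ∧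
      (∀ i : ℕ, ∀ s ∈ Set.Icc (0 : ℝ) 1, |h i s| ≤ D * ((i : ℝ) + 1) ^ (-p)) ∧
      (∀ i : ℕ, ∀ s ∈ Set.Icc (0 : ℝ) 1, |h i s| ≤ D * s) ∧
      (∀ s ∈ Set.Icc (0 : ℝ) 1, ∀ ψ, HasSum (fun i : ℕ => h i s * sin ((2 * i + 1 : ℕ) * ψ))
        (s ^ α * signedPow p (oddSeries (fun i => radSol (n * (2 * i + 1)) (h i) s) ψ))) ∧
      ∃ s ∈ Set.Icc (0 : ℝ) 1, ∃ ψ,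
        oddSeries (fun i => radSol (n * (2 * i + 1)) (h i) s) ψ ≠ 0 := by
  obtain ⟨w, hw, hfix⟩ := exists_cyl_fixed_point hα hn hp (by linarith)
  set g := cylExt (powMap p hp w) with hg
  set h : ℕ → ℝ → ℝ := fun i => modeSrc α (2 * i + 1) g with hh
  set R : ℝ → ℕ → ℝ := fun s i => radSol (n * (2 * i + 1)) (h i) s with hR
  set M := ‖powMap p hp w‖ with hM
  have hM0 : 0 ≤ M := norm_nonneg _
  have hb0 : ∀ i s, |sinCoef (2 * i + 1) (g s)| ≤ 2 * M := fun i s =>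
    abs_sinCoef_le _ fun _ _ => abs_cylExt_le _ _ _
  have hR0 : ∀ s ∈ Set.Icc (0 : ℝ) 1, ∀ i : ℕ,
      |R s i| ≤ 4 * M * s ^ 2 * ((i : ℝ) + 1) ^ (-2 : ℝ) := fun s hs i => by
    have := abs_radSol_le_succ_rpow hn i (h := h i) (D := 2 * M) (e := 0) (by positivity)
      (fun t ht => by simpa using abs_modeSrc_le hα _ ht (hb0 i t)) hs
    rw [zero_add] at this
    exact this.trans_eq (by ring)
  have hR1 : ∀ s ∈ Set.Icc (0 : ℝ) 1, ∀ i : ℕ,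
      |R s i| ≤ 4 * M * ((i : ℝ) + 1) ^ (-2 : ℝ) := fun s hs i => by
    refine (hR0 s hs i).trans (mul_le_mul_of_nonneg_right ?_ (by positivity))
    exact mul_le_of_le_one_right (by positivity) (pow_le_one₀ hs.1 hs.2)
  have hv : ∀ s (hs : s ∈ Set.Icc (0 : ℝ) 1), ∀ ψ (hψ : ψ ∈ Set.Icc (0 : ℝ) (2 * π)),
      oddSeries (R s) ψ = w (⟨s, hs⟩, ⟨ψ, hψ⟩) := fun s hs ψ hψ => by
    have := hasSum_radSol_mul_sin hα hn (powMap p hp w) (⟨s, hs⟩, ⟨ψ, hψ⟩)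
    rw [hfix] at this
    exact this.tsum_eq
  have hgv : ∀ s ∈ Set.Icc (0 : ℝ) 1, ∀ i, sinCoef (2 * i + 1) (g s) =
      sinCoef (2 * i + 1) fun ψ => signedPow p (oddSeries (R s) ψ) := fun s hs i => by
    rw [sinCoef, sinCoef]
    congr 1
    refine intervalIntegral.integral_congr fun ψ hψ => ?_
    rw [Set.uIcc_of_le two_pi_pos.le] at hψ
    simp only [hg, cylExt_mk _ hs hψ, powMap_apply, hv s hs ψ hψ]
  obtain ⟨D₁, hD₁, hb1⟩ : ∃ D₁ : ℝ, 0 ≤ D₁ ∧ ∀ s ∈ Set.Icc (0 : ℝ) 1, ∀ i : ℕ,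
      |sinCoef (2 * i + 1) (g s)| ≤ D₁ * ((i : ℝ) + 1) ^ (-(1 / 2) : ℝ) := by
    refine ⟨_, ?_, fun s hs i => (hgv s hs i).symm ▸
      abs_sinCoef_signedPow_le_of_two hp (by positivity : 0 ≤ 4 * M) (hR1 s hs) i⟩
    have hz := succZeta_nonneg
    have := hz 2
    have := hz (2 - 1 / 2)
    have : 0 ≤ p := by linarith
    positivity
  have hR2 : ∀ s ∈ Set.Icc (0 : ℝ) 1, ∀ i : ℕ,
      |R s i| ≤ 2 * D₁ * ((i : ℝ) + 1) ^ (-(5 / 2) : ℝ) := fun s hs i => by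
    have := abs_radSol_le_succ_rpow hn i (h := h i) hD₁
      (fun t ht => abs_modeSrc_le hα _ ht (hb1 t ht i)) hs
    rw [show (1 / 2 + 2 : ℝ) = 5 / 2 by norm_num] at this
    refine this.trans (mul_le_mul_of_nonneg_right ?_ (by positivity))
    exact mul_le_of_le_one_right (by positivity) (pow_le_one₀ hs.1 hs.2)
  obtain ⟨D₂, hD₂, hb2⟩ := exists_sinCoef_signedPow_le hp hp2 (by positivity : 0 ≤ 2 * D₁)
  have hb2 : ∀ s ∈ Set.Icc (0 : ℝ) 1, ∀ i : ℕ,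
      |sinCoef (2 * i + 1) (g s)| ≤ D₂ * ((i : ℝ) + 1) ^ (-p) := fun s hs i =>
    (hgv s hs i).symm ▸ hb2 _ (hR2 s hs) i
  set A : ℝ := 4 * M * succZeta 2 with hA
  have hA0 : 0 ≤ A := mul_nonneg (by positivity) (succZeta_nonneg _)
  have hb3 : ∀ s ∈ Set.Icc (0 : ℝ) 1, ∀ i : ℕ,
      |sinCoef (2 * i + 1) (g s)| ≤ 2 * A ^ p * s := fun s hs i => by
    rw [hgv s hs i, mul_assoc]
    refine abs_sinCoef_le _ fun ψ _ => ?_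
    rw [abs_signedPow hp]
    have h1 := abs_oddSeries_le one_lt_two (hR0 s hs) ψ
    have hs2 : (s ^ 2) ^ p ≤ s := by
      rw [← Real.rpow_natCast, ← Real.rpow_mul hs.1]
      simpa using Real.rpow_le_rpow_of_exponent_ge' hs.1 hs.2 (z := 1)
        (y := ((2 : ℕ) : ℝ) * p) (by norm_num) (by push_cast; linarith)
    calc |oddSeries (R s) ψ| ^ p ≤ (A * s ^ 2) ^ p := by
          gcongr
          exact h1.trans_eq (by rw [hA]; ring)
      _ = A ^ p * (s ^ 2) ^ p := Real.mul_rpow hA0 (sq_nonneg s)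
      _ ≤ A ^ p * s := by gcongr
  refine ⟨h, D₂ + 2 * A ^ p, by positivity, fun i => continuous_modeSrc hα _ (continuous_cylExt _),
    fun i s hs => (abs_modeSrc_le hα _ hs (hb2 s hs i)).trans ?_,
    fun i s hs => (abs_modeSrc_le hα _ hs (hb3 s hs i)).trans ?_, fun s hs ψ => ?_, ?_⟩
  · gcongr
    have : 0 ≤ A ^ p := by positivity
    linarith
  · have := hs.1
    gcongr
    linarith
  · have hsum : Summable fun i : ℕ =>
        sinCoef (2 * i + 1) fun ψ => signedPow p (oddSeries (R s) ψ) := by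
      refine Summable.of_norm_bounded ((summable_succ_rpow hp).mul_left D₂) fun i => ?_
      rw [← hgv s hs i]
      exact hb2 s hs i
    have := (hasSum_sinCoef (continuous_signedPow_oddSeries hp one_lt_two (hR1 s hs))
      (signedPow_oddSeries_add_pi p (R s))
      (fun x => by rw [oddSeries_neg, signedPow_neg]) hsum ψ).mul_left (s ^ α)
    refine this.congr_fun fun i => ?_
    rw [← hgv s hs i, ← mul_assoc]
    rfl
  · obtain ⟨x, hx⟩ := DFunLike.ne_iff.1 hw
    exact ⟨x.1, x.1.2, x.2, by rw [hv x.1 x.1.2 x.2 x.2.2]; exact hx⟩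

/-- The real-linear map of the complex plane with Wirtinger coefficients `a` and `b`. -/
def wirt (a b : ℂ) : ℂ →L[ℝ] ℂ :=
  a • ContinuousLinearMap.id ℝ ℂ + b • (Complex.conjCLE : ℂ →L[ℝ] ℂ)

@[simp] lemma wirt_apply (a b w : ℂ) : wirt a b w = a * w + b * conj w := by simp [wirt]

lemma wirt_zero : wirt 0 0 = 0 := by ext; simp

section

variable {f g : ℂ → ℂ} {a b c d z : ℂ}

lemma HasDerivAt.hasFDerivAt_wirt (hf : HasDerivAt f a z) : HasFDerivAt f (wirt a 0) z := by
  refine (hf.hasFDerivAt.restrictScalars ℝ).congr_fderiv ?_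
  ext w; simp [mul_comm]

lemma HasDerivAt.hasFDerivAt_wirt_conj (hf : HasDerivAt f a (conj z)) :
    HasFDerivAt (fun w => f (conj w)) (wirt 0 a) z := by
  have h := (hf.hasFDerivAt.restrictScalars ℝ).comp z (Complex.conjCLE : ℂ →L[ℝ] ℂ).hasFDerivAt
  refine h.congr_fderiv ?_
  ext w; simp [mul_comm]

lemma hasFDerivAt_wirt_mul (hf : HasFDerivAt f (wirt a b) z) (hg : HasFDerivAt g (wirt c d) z) :
    HasFDerivAt (fun w => f w * g w) (wirt (a * g z + f z * c) (b * g z + f z * d)) z := by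
  refine (hf.mul hg).congr_fderiv ?_
  ext w; simp; ring

lemma hasFDerivAt_wirt_add (hf : HasFDerivAt f (wirt a b) z) (hg : HasFDerivAt g (wirt c d) z) :
    HasFDerivAt (fun w => f w + g w) (wirt (a + c) (b + d)) z := by
  refine (hf.add hg).congr_fderiv ?_
  ext w; simp; ring

lemma hasFDerivAt_wirt_radial {φ : ℝ → ℝ} {t : ℝ} (hz : z ≠ 0) (hφ : HasDerivAt φ t ‖z‖) :
    HasFDerivAt (fun w : ℂ => (φ ‖w‖ : ℂ))
      (wirt (t * conj z / (2 * ‖z‖)) (t * z / (2 * ‖z‖))) z := by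
  have h0 : HasFDerivAt (fun w : ℂ => ‖w‖) _ z := (hasStrictFDerivAt_norm_sq z).hasFDerivAt.sqrt
    (by simpa using hz) |>.congr_of_eventuallyEq (Eventually.of_forall fun w => by simp)
  have h1 := Complex.ofRealCLM.hasFDerivAt.comp z (hφ.comp_hasFDerivAt z h0)
  refine h1.congr_fderiv ?_
  have hz' : (‖z‖ : ℂ) ≠ 0 := by simpa using hz
  ext w
  have h2 : conj z * w + z * conj w = 2 * (w.re * z.re + w.im * z.im) := by
    apply Complex.ext <;> simp <;> ring
  simp only [ContinuousLinearMap.comp_apply, smul_apply, innerSL_apply_apply,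
    Complex.inner, Complex.ofRealCLM_apply, wirt_apply, smul_eq_mul, nsmul_eq_mul]
  simp
  field_simp
  linear_combination (-t) * h2

end

/-- The planar function `radCoef m h |z| * z ^ m`. -/
def mode (m : ℕ) (h : ℝ → ℝ) (z : ℂ) : ℂ := radCoef m h ‖z‖ * z ^ m

/-- The derivative of `mode` in `z`. -/
def modeZ (m : ℕ) (h : ℝ → ℝ) (z : ℂ) : ℂ :=
  m * (radCoef m h ‖z‖ * z ^ (m - 1)) - radInt m h ‖z‖ * (2 * (z * conj z ^ m))⁻¹

/-- The derivative of `mode` in the conjugate variable. -/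
def modeW (m : ℕ) (h : ℝ → ℝ) (z : ℂ) : ℂ := -(radInt m h ‖z‖ * (2 * conj z ^ (m + 1))⁻¹)

/-- The second derivative of `mode` in `z`. -/
def modeZZ (m : ℕ) (h : ℝ → ℝ) (z : ℂ) : ℂ :=
  m * ((m - 1 : ℕ) * (radCoef m h ‖z‖ * z ^ (m - 2))) -
    (m - 1 : ℕ) * (radInt m h ‖z‖ * (2 * (z ^ 2 * conj z ^ m))⁻¹) -
    h ‖z‖ * (‖z‖ ^ m * (4 * (z * conj z ^ (m - 1)))⁻¹)

/-- The mixed second derivative of `mode`. -/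
def modeZW (m : ℕ) (h : ℝ → ℝ) (z : ℂ) : ℂ := -(h ‖z‖ * (z ^ m * (4 * (‖z‖ : ℂ) ^ m)⁻¹))

/-- The second derivative of `mode` in the conjugate variable. -/
def modeWW (m : ℕ) (h : ℝ → ℝ) (z : ℂ) : ℂ :=
  (m + 1 : ℕ) * (radInt m h ‖z‖ * (2 * conj z ^ (m + 2))⁻¹) -
    h ‖z‖ * (‖z‖ ^ m * (z * (4 * conj z ^ (m + 1))⁻¹))

lemma hasFDerivAt_wirt_inv_pow_mul (j k : ℕ) {z : ℂ} (hz : z ≠ 0) :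
    HasFDerivAt (fun w : ℂ => (w ^ j * conj w ^ k)⁻¹)
      (wirt (-(j * (z ^ (j + 1) * conj z ^ k)⁻¹)) (-(k * (z ^ j * conj z ^ (k + 1))⁻¹))) z := by
  have hzc : conj z ≠ 0 := by simpa using hz
  have key : ∀ (k : ℕ) {w : ℂ}, w ≠ 0 →
      HasDerivAt (fun w : ℂ => (w ^ k)⁻¹) (-(k * (w ^ (k + 1))⁻¹)) w := fun k w hw => by
    refine ((hasDerivAt_pow k w).fun_inv (pow_ne_zero k hw)).congr_deriv ?_
    rcases k with _ | k
    · simp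
    · simp only [Nat.add_sub_cancel]
      field_simp
      ring
  have h := hasFDerivAt_wirt_mul (key j hz).hasFDerivAt_wirt (key k hzc).hasFDerivAt_wirt_conj
  simp only [← mul_inv] at h
  refine h.congr_fderiv ?_
  congr 1
  · field_simp; ring
  · field_simp; ring

section

variable {m : ℕ} {h : ℝ → ℝ} {z : ℂ}

lemma hasFDerivAt_radCoef_norm (hh : Continuous h) (hz : z ≠ 0) :
    HasFDerivAt (fun w : ℂ => (radCoef m h ‖w‖ : ℂ))
      (wirt (-(radInt m h ‖z‖ * (2 * (z ^ (m + 1) * conj z ^ m))⁻¹))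
        (-(radInt m h ‖z‖ * (2 * (z ^ m * conj z ^ (m + 1)))⁻¹))) z := by
  have hz' : (‖z‖ : ℂ) ≠ 0 := by simpa using hz
  have hzc : conj z ≠ 0 := by simpa using hz
  have e : (‖z‖ : ℂ) ^ (2 * m + 1) * ‖z‖ = z ^ (m + 1) * conj z ^ (m + 1) := by
    rw [← mul_pow, Complex.mul_conj', ← pow_mul]; ring
  have h1 := hasFDerivAt_wirt_radial hz (hasDerivAt_radCoef (m := m) hh (norm_pos_iff.2 hz))
  have key : ∀ w : ℂ, ((-(radInt m h ‖z‖ / ‖z‖ ^ (2 * m + 1)) : ℝ) : ℂ) * w / (2 * ‖z‖) =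
      -(radInt m h ‖z‖ * (w * (2 * (z ^ (m + 1) * conj z ^ (m + 1)))⁻¹)) := fun w => by
    rw [← e]
    push_cast
    field_simp
  rw [key, key] at h1
  refine h1.congr_fderiv ?_
  congr 1
  · field_simp
    ring
  · field_simp
    ring

lemma hasFDerivAt_radInt_norm (hh : Continuous h) (hz : z ≠ 0) :
    HasFDerivAt (fun w : ℂ => (radInt m h ‖w‖ : ℂ))
      (wirt (h ‖z‖ * (‖z‖ ^ m * (conj z / 2))) (h ‖z‖ * (‖z‖ ^ m * (z / 2)))) z := by
  have hz' : (‖z‖ : ℂ) ≠ 0 := by simpa using hz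
  refine (hasFDerivAt_wirt_radial hz (hasDerivAt_radInt (m := m) hh ‖z‖)).congr_fderiv ?_
  congr 1 <;>
  · push_cast
    field_simp
    ring

lemma hasFDerivAt_mode (hh : Continuous h) (hz : z ≠ 0) :
    HasFDerivAt (mode m h) (wirt (modeZ m h z) (modeW m h z)) z := by
  have hzc : conj z ≠ 0 := by simpa using hz
  refine (hasFDerivAt_wirt_mul (hasFDerivAt_radCoef_norm (m := m) hh hz)
    (hasDerivAt_pow m z).hasFDerivAt_wirt).congr_fderiv ?_
  congr 1
  · rw [modeZ]
    field_simp
    ring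
  · rw [modeW]
    field_simp
    ring

lemma hasFDerivAt_modeZ (hm : 2 ≤ m) (hh : Continuous h) (hz : z ≠ 0) :
    HasFDerivAt (modeZ m h) (wirt (modeZZ m h z) (modeZW m h z)) z := by
  obtain ⟨m, rfl⟩ := Nat.exists_eq_add_of_le' hm
  have hz' : (‖z‖ : ℂ) ≠ 0 := by simpa using hz
  have hzc : conj z ≠ 0 := by simpa using hz
  have e : ((‖z‖ : ℂ) ^ (m + 2)) ^ 2 = z ^ (m + 2) * conj z ^ (m + 2) := by
    rw [← mul_pow, Complex.mul_conj', ← pow_mul, ← pow_mul, mul_comm]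
  have h1 := hasFDerivAt_wirt_add
    (hasFDerivAt_wirt_mul (hasFDerivAt_radCoef_norm (m := m + 2) hh hz)
      (((hasDerivAt_pow (m + 1) z).const_mul ((m + 2 : ℕ) : ℂ)).hasFDerivAt_wirt))
    (hasFDerivAt_wirt_mul (hasFDerivAt_radInt_norm (m := m + 2) hh hz)
      (hasFDerivAt_wirt_mul (hasDerivAt_const z (-(1 / 2) : ℂ)).hasFDerivAt_wirt
        (hasFDerivAt_wirt_inv_pow_mul 1 (m + 2) hz)))
  refine (h1.congr_of_eventuallyEq (Eventually.of_forall fun w => ?_)).congr_fderiv ?_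
  · simp only [modeZ, show m + 2 - 1 = m + 1 from rfl]
    ring
  congr 1
  · simp only [modeZZ, show m + 2 - 1 = m + 1 from rfl, Nat.add_sub_cancel]
    push_cast
    field_simp
    ring
  · simp only [modeZW]
    push_cast
    field_simp
    linear_combination (-4) * h ‖z‖ * z ^ (m + 3) * conj z ^ (m + 3) * e

lemma hasFDerivAt_modeW (hh : Continuous h) (hz : z ≠ 0) :
    HasFDerivAt (modeW m h) (wirt (modeZW m h z) (modeWW m h z)) z := by
  have hz' : (‖z‖ : ℂ) ≠ 0 := by simpa using hz
  have hzc : conj z ≠ 0 := by simpa using hz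
  have e : (‖z‖ : ℂ) ^ m * (conj z * (conj z ^ (m + 1))⁻¹) = z ^ m * ((‖z‖ : ℂ) ^ m)⁻¹ := by
    have : ((‖z‖ : ℂ) ^ m) ^ 2 = z ^ m * conj z ^ m := by
      rw [← mul_pow, Complex.mul_conj', ← pow_mul, ← pow_mul, mul_comm]
    field_simp
    linear_combination this * conj z
  have h1 := hasFDerivAt_wirt_mul ((hasDerivAt_const z (-(1 / 2) : ℂ)).hasFDerivAt_wirt)
    (hasFDerivAt_wirt_mul (hasFDerivAt_radInt_norm (m := m) hh hz)
      (hasFDerivAt_wirt_inv_pow_mul 0 (m + 1) hz))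
  refine (h1.congr_of_eventuallyEq (Eventually.of_forall fun w => ?_)).congr_fderiv ?_
  · simp only [modeW]
    ring
  congr 1
  · simp only [modeZW, pow_zero, one_mul, Nat.cast_zero, mul_inv]
    linear_combination (-1 / 4) * h ‖z‖ * e
  · simp only [modeWW, pow_zero, one_mul, mul_inv]
    ring

end

section

variable {m d : ℕ} {h : ℝ → ℝ} {B : ℝ} {z : ℂ}

lemma norm_radInt_mul_inv_le (hB : 0 ≤ B) (hm : m ≠ 0)
    (hb : ∀ s ∈ Set.Icc (0 : ℝ) 1, |h s| ≤ B * s ^ d) (hz0 : z ≠ 0) (hz : ‖z‖ ≤ 1) {w : ℂ} {j e : ℕ}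
    (hw : ‖w‖ = ‖z‖ ^ (m + j)) (hj : j + e = 2) :
    ‖(radInt m h ‖z‖ : ℂ) * (2 * w)⁻¹‖ ≤ B / m / 2 * ‖z‖ ^ (d + e) := by
  have hr : 0 < ‖z‖ := norm_pos_iff.2 hz0
  rw [norm_mul, norm_inv, norm_mul, hw, Complex.norm_real, Complex.norm_two, Real.norm_eq_abs]
  calc _ ≤ B / m * ‖z‖ ^ (m + (2 + d)) * (2 * ‖z‖ ^ (m + j))⁻¹ := by
        gcongr
        exact abs_radInt_le hm hB hb ⟨hr.le, hz⟩
    _ = B / m / 2 * ‖z‖ ^ (d + e) := by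
        rw [← hj, show m + (j + e + d) = (d + e) + (m + j) by ring, pow_add _ (d + e)]
        field_simp

lemma norm_radCoef_mul_pow_le (hB : 0 ≤ B) (hm : 2 * (d + 2) ≤ m)
    (hb : ∀ s ∈ Set.Icc (0 : ℝ) 1, |h s| ≤ B * s ^ d) (hz0 : z ≠ 0) (hz : ‖z‖ ≤ 1) {k j e : ℕ}
    (hk : k + j = m) (hj : j + e = 2) :
    ‖(radCoef m h ‖z‖ : ℂ) * z ^ k‖ ≤ 2 * B / m ^ 2 * ‖z‖ ^ (d + e) := by
  have hr : 0 < ‖z‖ := norm_pos_iff.2 hz0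
  have h1 := abs_radCoef_le hB hm hb ⟨hr, hz⟩
  rw [norm_mul, norm_pow, Complex.norm_real, Real.norm_eq_abs]
  refine le_of_mul_le_mul_right ?_ (pow_pos hr j)
  calc _ = ‖z‖ ^ m * |radCoef m h ‖z‖| := by rw [← hk, pow_add]; ring
    _ ≤ _ := h1
    _ = _ := by rw [← hj, mul_assoc, ← pow_add]; congr 2; ring

lemma norm_source_mul_le (hb : ∀ s ∈ Set.Icc (0 : ℝ) 1, |h s| ≤ B * s ^ d)
    (hz : ‖z‖ ≤ 1) {w : ℂ} (hw : ‖w‖ = 1 / 4) :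
    ‖(h ‖z‖ : ℂ) * w‖ ≤ B / 4 * ‖z‖ ^ d := by
  rw [norm_mul, hw, Complex.norm_real, Real.norm_eq_abs]
  linarith [hb _ ⟨norm_nonneg z, hz⟩]

lemma mode_zero (hm : m ≠ 0) : mode m h 0 = 0 := by simp [mode, hm]

lemma modeZ_zero (hm : 2 ≤ m) : modeZ m h 0 = 0 := by
  simp [modeZ, show m - 1 ≠ 0 by omega]

lemma modeW_zero : modeW m h 0 = 0 := by simp [modeW]

lemma modeZZ_zero (hm : 3 ≤ m) : modeZZ m h 0 = 0 := by
  simp [modeZZ, show m - 2 ≠ 0 by omega, show m ≠ 0 by omega]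

lemma modeZW_zero (hm : m ≠ 0) : modeZW m h 0 = 0 := by simp [modeZW, hm]

lemma modeWW_zero : modeWW m h 0 = 0 := by simp [modeWW]

lemma norm_mode_le (hB : 0 ≤ B) (hm : 2 * (d + 2) ≤ m)
    (hb : ∀ s ∈ Set.Icc (0 : ℝ) 1, |h s| ≤ B * s ^ d) (hz : ‖z‖ ≤ 1) :
    ‖mode m h z‖ ≤ 4 * B * ‖z‖ ^ (d + 2) := by
  rcases eq_or_ne z 0 with rfl | hz0
  · rw [mode_zero (by omega), norm_zero]; positivity
  refine (norm_radCoef_mul_pow_le hB hm hb hz0 hz (j := 0) (e := 2) rfl rfl).trans ?_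
  have hm1 : (1 : ℝ) ≤ m := by norm_cast; omega
  gcongr
  rw [div_le_iff₀ (by positivity)]
  nlinarith [mul_nonneg hB (sub_nonneg.2 (one_le_pow₀ (n := 2) hm1))]

lemma norm_modeZ_le (hB : 0 ≤ B) (hm : 2 * (d + 2) ≤ m)
    (hb : ∀ s ∈ Set.Icc (0 : ℝ) 1, |h s| ≤ B * s ^ d) (hz : ‖z‖ ≤ 1) :
    ‖modeZ m h z‖ ≤ 4 * B * ‖z‖ ^ (d + 1) := by
  rcases eq_or_ne z 0 with rfl | hz0
  · rw [modeZ_zero (by omega), norm_zero]; positivity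
  have hm1 : (1 : ℝ) ≤ m := by norm_cast; omega
  have h1 := norm_radCoef_mul_pow_le hB hm hb hz0 hz (k := m - 1) (j := 1) (e := 1) (by omega) rfl
  have h2 := norm_radInt_mul_inv_le (m := m) (w := z * conj z ^ m) hB (by omega) hb hz0 hz
    (j := 1) (e := 1) (by simp [pow_succ']) rfl
  have h3 : B / m ≤ B := div_le_self hB hm1
  refine (norm_sub_le _ _).trans ?_
  rw [norm_mul, Complex.norm_natCast]
  calc _ ≤ m * (2 * B / m ^ 2 * ‖z‖ ^ (d + 1)) + B / m / 2 * ‖z‖ ^ (d + 1) := by gcongr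
    _ = 5 / 2 * (B / m) * ‖z‖ ^ (d + 1) := by field_simp; ring
    _ ≤ 4 * B * ‖z‖ ^ (d + 1) := by
      gcongr; norm_num

lemma norm_modeW_le (hB : 0 ≤ B) (hm : 2 * (d + 2) ≤ m)
    (hb : ∀ s ∈ Set.Icc (0 : ℝ) 1, |h s| ≤ B * s ^ d) (hz : ‖z‖ ≤ 1) :
    ‖modeW m h z‖ ≤ 4 * B * ‖z‖ ^ (d + 1) := by
  rcases eq_or_ne z 0 with rfl | hz0
  · rw [modeW_zero, norm_zero]; positivity
  have hm1 : (1 : ℝ) ≤ m := by norm_cast; omega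
  have h2 := norm_radInt_mul_inv_le (m := m) (w := conj z ^ (m + 1)) hB (by omega) hb hz0 hz
    (j := 1) (e := 1) (by simp) rfl
  have h3 : B / m ≤ B := div_le_self hB hm1
  rw [modeW, norm_neg]
  refine h2.trans ?_
  gcongr
  linarith

lemma norm_modeZZ_le (hB : 0 ≤ B) (hm : 2 * (d + 2) ≤ m)
    (hb : ∀ s ∈ Set.Icc (0 : ℝ) 1, |h s| ≤ B * s ^ d) (hz : ‖z‖ ≤ 1) :
    ‖modeZZ m h z‖ ≤ 4 * B * ‖z‖ ^ d := by
  rcases eq_or_ne z 0 with rfl | hz0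
  · rw [modeZZ_zero (by omega), norm_zero]; positivity
  have hm1 : (1 : ℝ) ≤ m := by norm_cast; omega
  have hm2 : ((m - 1 : ℕ) : ℝ) ≤ m := by norm_cast; omega
  have h1 := norm_radCoef_mul_pow_le hB hm hb hz0 hz (k := m - 2) (j := 2) (e := 0) (by omega) rfl
  have h2 := norm_radInt_mul_inv_le (m := m) (w := z ^ 2 * conj z ^ m) hB (by omega) hb hz0 hz
    (j := 2) (e := 0) (by simp [pow_add, mul_comm]) rfl
  have h3 := norm_source_mul_le (w := ‖z‖ ^ m * (4 * (z * conj z ^ (m - 1)))⁻¹) hb hz (by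
    have hr : ‖z‖ ≠ 0 := norm_ne_zero_iff.2 hz0
    have : ‖z‖ ^ m = ‖z‖ * ‖z‖ ^ (m - 1) := by rw [← pow_succ']; congr 1; omega
    simp [this]
    field_simp)
  refine (norm_sub_le _ _).trans ((add_le_add_left (norm_sub_le _ _) _).trans ?_)
  rw [norm_mul, norm_mul, norm_mul ((m - 1 : ℕ) : ℂ), Complex.norm_natCast, Complex.norm_natCast]
  calc _ ≤ m * (m * (2 * B / m ^ 2 * ‖z‖ ^ (d + 0))) + m * (B / m / 2 * ‖z‖ ^ (d + 0)) +
        B / 4 * ‖z‖ ^ d := by gcongr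
    _ = 11 / 4 * B * ‖z‖ ^ d := by rw [add_zero]; field_simp; ring
    _ ≤ 4 * B * ‖z‖ ^ d := by
      gcongr; norm_num

lemma norm_modeZW_le (hB : 0 ≤ B) (hm : 2 * (d + 2) ≤ m)
    (hb : ∀ s ∈ Set.Icc (0 : ℝ) 1, |h s| ≤ B * s ^ d) (hz : ‖z‖ ≤ 1) :
    ‖modeZW m h z‖ ≤ 4 * B * ‖z‖ ^ d := by
  rcases eq_or_ne z 0 with rfl | hz0
  · rw [modeZW_zero (by omega), norm_zero]; positivity
  rw [modeZW, norm_neg]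
  refine (norm_source_mul_le hb hz (by
    have hr : ‖z‖ ≠ 0 := norm_ne_zero_iff.2 hz0
    simp
    field_simp)).trans ?_
  gcongr
  linarith

lemma norm_modeWW_le (hB : 0 ≤ B) (hm : 2 * (d + 2) ≤ m)
    (hb : ∀ s ∈ Set.Icc (0 : ℝ) 1, |h s| ≤ B * s ^ d) (hz : ‖z‖ ≤ 1) :
    ‖modeWW m h z‖ ≤ 4 * B * ‖z‖ ^ d := by
  rcases eq_or_ne z 0 with rfl | hz0
  · rw [modeWW_zero, norm_zero]; positivity
  have hm1 : (1 : ℝ) ≤ m := by norm_cast; omega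
  have h2 := norm_radInt_mul_inv_le (m := m) (w := conj z ^ (m + 2)) hB (by omega) hb hz0 hz
    (j := 2) (e := 0) (by simp) rfl
  have h3 := norm_source_mul_le (w := ‖z‖ ^ m * (z * (4 * conj z ^ (m + 1))⁻¹)) hb hz (by
    have hr : ‖z‖ ≠ 0 := norm_ne_zero_iff.2 hz0
    simp [pow_succ]
    field_simp)
  refine (norm_sub_le _ _).trans ?_
  rw [norm_mul, Complex.norm_natCast]
  have hm2 : ((m + 1 : ℕ) : ℝ) ≤ 2 * m := by push_cast; linarith
  calc _ ≤ 2 * m * (B / m / 2 * ‖z‖ ^ (d + 0)) + B / 4 * ‖z‖ ^ d := by gcongr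
    _ = 5 / 4 * B * ‖z‖ ^ d := by rw [add_zero]; field_simp; ring
    _ ≤ 4 * B * ‖z‖ ^ d := by
      gcongr; norm_num

lemma hasFDerivAt_zero_of_norm_le {f : ℂ → ℂ} {C : ℝ} (h0 : f 0 = 0)
    (hf : ∀ z, ‖z‖ ≤ 1 → ‖f z‖ ≤ C * ‖z‖ ^ 2) : HasFDerivAt f (wirt 0 0) 0 := by
  rw [wirt_zero]
  refine HasFDerivAt.of_isLittleO ?_
  have h1 : f =O[𝓝 0] fun z => ‖z‖ ^ 2 := by
    refine Asymptotics.IsBigO.of_bound C ?_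
    filter_upwards [closedBall_mem_nhds (0 : ℂ) one_pos] with z hz
    simpa using hf z (by simpa using hz)
  have h2 : (fun z : ℂ => ‖z‖ ^ 2) =o[𝓝 0] fun z => z := by
    simpa using Asymptotics.isLittleO_norm_pow_id (E' := ℂ) one_lt_two
  simpa [h0] using h1.trans_isLittleO h2

lemma continuousAt_zero_of_norm_le {f : ℂ → ℂ} {C : ℝ} (h0 : f 0 = 0)
    (hf : ∀ z, ‖z‖ ≤ 1 → ‖f z‖ ≤ C * ‖z‖) : ContinuousAt f 0 := by
  rw [ContinuousAt, h0]
  refine squeeze_zero_norm' (a := fun z => C * ‖z‖) ?_ ?_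
  · filter_upwards [closedBall_mem_nhds (0 : ℂ) one_pos] with z hz
    exact hf z (by simpa using hz)
  · exact Continuous.tendsto' (by fun_prop) _ _ (by simp)

lemma hasFDerivAt_wirt_mode (hB : 0 ≤ B) (hm : 6 ≤ m) (hh : Continuous h)
    (hb : ∀ s ∈ Set.Icc (0 : ℝ) 1, |h s| ≤ B * s) (z : ℂ) :
    HasFDerivAt (mode m h) (wirt (modeZ m h z) (modeW m h z)) z := by
  rcases eq_or_ne z 0 with rfl | hz
  · rw [modeZ_zero (by omega), modeW_zero]
    refine hasFDerivAt_zero_of_norm_le (C := 4 * B) (mode_zero (by omega)) fun z hz => ?_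
    refine norm_mode_le (d := 0) hB (by omega) (fun s hs => ?_) hz
    simpa using (hb s hs).trans (mul_le_of_le_one_right hB hs.2)
  · exact hasFDerivAt_mode hh hz

lemma hasFDerivAt_wirt_modeZ (hB : 0 ≤ B) (hm : 6 ≤ m) (hh : Continuous h)
    (hb : ∀ s ∈ Set.Icc (0 : ℝ) 1, |h s| ≤ B * s) (z : ℂ) :
    HasFDerivAt (modeZ m h) (wirt (modeZZ m h z) (modeZW m h z)) z := by
  rcases eq_or_ne z 0 with rfl | hz
  · rw [modeZZ_zero (by omega), modeZW_zero (by omega)]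
    exact hasFDerivAt_zero_of_norm_le (C := 4 * B) (modeZ_zero (by omega)) fun z hz =>
      norm_modeZ_le (d := 1) hB (by omega) (by simpa using hb) hz
  · exact hasFDerivAt_modeZ (by omega) hh hz

lemma hasFDerivAt_wirt_modeW (hB : 0 ≤ B) (hm : 6 ≤ m) (hh : Continuous h)
    (hb : ∀ s ∈ Set.Icc (0 : ℝ) 1, |h s| ≤ B * s) (z : ℂ) :
    HasFDerivAt (modeW m h) (wirt (modeZW m h z) (modeWW m h z)) z := by
  rcases eq_or_ne z 0 with rfl | hz
  · rw [modeWW_zero, modeZW_zero (by omega)]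
    exact hasFDerivAt_zero_of_norm_le (C := 4 * B) modeW_zero fun z hz =>
      norm_modeW_le (d := 1) hB (by omega) (by simpa using hb) hz
  · exact hasFDerivAt_modeW hh hz

lemma continuous_modeZZ (hB : 0 ≤ B) (hm : 6 ≤ m) (hh : Continuous h)
    (hb : ∀ s ∈ Set.Icc (0 : ℝ) 1, |h s| ≤ B * s) :
    Continuous (modeZZ m h) := by
  refine continuous_iff_continuousAt.2 fun z => ?_
  rcases eq_or_ne z 0 with rfl | hz
  · refine continuousAt_zero_of_norm_le (C := 4 * B) (modeZZ_zero (by omega)) fun z hz => ?_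
    simpa using norm_modeZZ_le (d := 1) hB (by omega) (by simpa using hb) hz
  · have h1 := (hasFDerivAt_radCoef_norm (m := m) hh hz).continuousAt
    have h2 := (hasFDerivAt_radInt_norm (m := m) hh hz).continuousAt
    unfold modeZZ
    fun_prop (disch := simp [hz])

lemma continuous_modeZW (hB : 0 ≤ B) (hm : 6 ≤ m) (hh : Continuous h)
    (hb : ∀ s ∈ Set.Icc (0 : ℝ) 1, |h s| ≤ B * s) :
    Continuous (modeZW m h) := by
  refine continuous_iff_continuousAt.2 fun z => ?_
  rcases eq_or_ne z 0 with rfl | hz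
  · refine continuousAt_zero_of_norm_le (C := 4 * B) (modeZW_zero (by omega)) fun z hz => ?_
    simpa using norm_modeZW_le (d := 1) hB (by omega) (by simpa using hb) hz
  · unfold modeZW
    fun_prop (disch := simp [hz])

lemma continuous_modeWW (hB : 0 ≤ B) (hm : 6 ≤ m) (hh : Continuous h)
    (hb : ∀ s ∈ Set.Icc (0 : ℝ) 1, |h s| ≤ B * s) :
    Continuous (modeWW m h) := by
  refine continuous_iff_continuousAt.2 fun z => ?_
  rcases eq_or_ne z 0 with rfl | hz
  · refine continuousAt_zero_of_norm_le (C := 4 * B) modeWW_zero fun z hz => ?_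
    simpa using norm_modeWW_le (d := 1) hB (by omega) (by simpa using hb) hz
  · have h2 := (hasFDerivAt_radInt_norm (m := m) hh hz).continuousAt
    unfold modeWW
    fun_prop (disch := simp [hz])

end

lemma hasFDerivAt_wirt_tsum {f a b : ℕ → ℂ → ℂ} {c : ℕ → ℝ} (hc : Summable c)
    (hf : ∀ i z, HasFDerivAt (f i) (wirt (a i z) (b i z)) z)
    (hfc : ∀ i, ∀ z ∈ ball (0 : ℂ) 1, ‖f i z‖ ≤ c i)
    (ha : ∀ i, ∀ z ∈ ball (0 : ℂ) 1, ‖a i z‖ ≤ c i)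
    (hb : ∀ i, ∀ z ∈ ball (0 : ℂ) 1, ‖b i z‖ ≤ c i) {z : ℂ} (hz : z ∈ ball (0 : ℂ) 1) :
    HasFDerivAt (fun w => ∑' i, f i w) (wirt (∑' i, a i z) (∑' i, b i z)) z := by
  have key := hasFDerivAt_tsum_of_isPreconnected (𝕜 := ℝ) (hc.mul_left 2) isOpen_ball
    (convex_ball (0 : ℂ) 1).isPreconnected (fun i w _ => hf i w) (fun i w hw => ?_)
    (mem_ball_self one_pos)
    (Summable.of_norm_bounded hc fun i => hfc i 0 (mem_ball_self one_pos)) hz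
  · refine key.congr_fderiv ?_
    have ha' : HasSum (fun i => a i z) (∑' i, a i z) :=
      (Summable.of_norm_bounded hc fun i => ha i z hz).hasSum
    have hb' : HasSum (fun i => b i z) (∑' i, b i z) :=
      (Summable.of_norm_bounded hc fun i => hb i z hz).hasSum
    exact ((ha'.smul_const _).add (hb'.smul_const _)).tsum_eq
  · refine ContinuousLinearMap.opNorm_le_bound _ (by
      have := (norm_nonneg _).trans (hfc i w hw); positivity) fun v => ?_
    rw [wirt_apply]
    refine (norm_add_le _ _).trans ?_
    rw [norm_mul, norm_mul, Complex.norm_conj]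
    nlinarith [ha i w hw, hb i w hw, norm_nonneg v]

lemma contDiffOn_of_hasFDerivAt_wirt {f a b : ℂ → ℂ} {s : Set ℂ} (hs : IsOpen s) {n : ℕ}
    (hf : ∀ z ∈ s, HasFDerivAt f (wirt (a z) (b z)) z) (ha : ContDiffOn ℝ n a s)
    (hb : ContDiffOn ℝ n b s) : ContDiffOn ℝ (n + 1) f s := by
  rw [contDiffOn_succ_iff_fderiv_of_isOpen hs]
  refine ⟨fun z hz => (hf z hz).differentiableAt.differentiableWithinAt, by simp, ?_⟩
  have h : ContDiffOn ℝ n (fun z => wirt (a z) (b z)) s :=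
    (ha.smul contDiffOn_const).add (hb.smul contDiffOn_const)
  exact h.congr fun z hz => (hf z hz).fderiv

/-- The identification of the Euclidean plane with the complex plane. -/
def toC : E2 →L[ℝ] ℂ :=
  (EuclideanSpace.proj (0 : Fin 2) : E2 →L[ℝ] ℝ).smulRight (1 : ℂ) +
    (EuclideanSpace.proj (1 : Fin 2) : E2 →L[ℝ] ℝ).smulRight Complex.I

lemma toC_apply (x : E2) : toC x = x 0 + x 1 * Complex.I := by simp [toC]

lemma norm_toC (x : E2) : ‖toC x‖ = ‖x‖ := by
  rw [toC_apply, Complex.norm_add_mul_I, EuclideanSpace.norm_eq]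
  simp

lemma toC_rot2 (θ : ℝ) (x : E2) : toC (rot2 θ x) = Complex.exp (θ * Complex.I) * toC x := by
  rw [toC_apply, toC_apply, Complex.exp_mul_I, ← Complex.ofReal_cos, ← Complex.ofReal_sin]
  apply Complex.ext <;> simp [rot2]
  ring

lemma exists_toC_eq (z : ℂ) : ∃ x : E2, toC x = z :=
  ⟨!₂[z.re, z.im], by rw [toC_apply]; simp⟩

lemma lap_im_comp_toC {V P Q : ℂ → ℂ} {a b c : ℂ} {x : E2} (hx : x ∈ ball (0 : E2) 1)
    (hV : ∀ z ∈ ball (0 : ℂ) 1, HasFDerivAt V (wirt (P z) (Q z)) z)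
    (hP : HasFDerivAt P (wirt a b) (toC x)) (hQ : HasFDerivAt Q (wirt b c) (toC x)) :
    lap (fun y => (V (toC y)).im) x = 4 * b.im := by
  have h1 : ∀ y ∈ ball (0 : E2) 1, ∀ e : E2, fderiv ℝ (fun y => (V (toC y)).im) y e =
      (P (toC y) * toC e + Q (toC y) * conj (toC e)).im := fun y hy e => by
    have := Complex.imCLM.hasFDerivAt.comp y ((hV (toC y) (by
      simpa [norm_toC] using hy)).comp y toC.hasFDerivAt)
    rw [HasFDerivAt.fderiv (f := fun y => (V (toC y)).im) this]
    simp
  have h2 : ∀ e : E2, fderiv ℝ (fun y => fderiv ℝ (fun y => (V (toC y)).im) y e) x e =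
      ((a * toC e + b * conj (toC e)) * toC e + (b * toC e + c * conj (toC e)) *
        conj (toC e)).im := fun e => by
    have h3 : (fun y => fderiv ℝ (fun y => (V (toC y)).im) y e) =ᶠ[𝓝 x]
        fun y => (P (toC y) * toC e + Q (toC y) * conj (toC e)).im := by
      filter_upwards [isOpen_ball.mem_nhds hx] with y hy using h1 y hy e
    have h4 := Complex.imCLM.hasFDerivAt.comp x (((hP.comp x toC.hasFDerivAt).mul_const (toC e)).add
      ((hQ.comp x toC.hasFDerivAt).mul_const (conj (toC e))))
    rw [h3.fderiv_eq, HasFDerivAt.fderiv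
      (f := fun y => (P (toC y) * toC e + Q (toC y) * conj (toC e)).im) h4]
    simp
    ring
  rw [lap, Fin.sum_univ_two, h2, h2]
  simp [toC_apply]
  ring

section

variable {m : ℕ → ℕ} {h : ℕ → ℝ → ℝ} {c : ℕ → ℝ} {D : ℝ}

lemma norm_modes_le (hm : ∀ i, 6 ≤ m i) (hc0 : ∀ i, 0 ≤ c i)
    (hb : ∀ i, ∀ s ∈ Set.Icc (0 : ℝ) 1, |h i s| ≤ c i) {z : ℂ} (hz : ‖z‖ ≤ 1) (i : ℕ) :
    ‖mode (m i) (h i) z‖ ≤ 4 * c i ∧ ‖modeZ (m i) (h i) z‖ ≤ 4 * c i ∧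
    ‖modeW (m i) (h i) z‖ ≤ 4 * c i ∧ ‖modeZZ (m i) (h i) z‖ ≤ 4 * c i ∧
    ‖modeZW (m i) (h i) z‖ ≤ 4 * c i ∧ ‖modeWW (m i) (h i) z‖ ≤ 4 * c i := by
  have h1 : 2 * (0 + 2) ≤ m i := by linarith [hm i]
  have h2 : ∀ s ∈ Set.Icc (0 : ℝ) 1, |h i s| ≤ c i * s ^ 0 := by simpa using hb i
  have h3 : ∀ e : ℕ, 4 * c i * ‖z‖ ^ e ≤ 4 * c i := fun e =>
    mul_le_of_le_one_right (by linarith [hc0 i]) (pow_le_one₀ (norm_nonneg z) hz)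
  exact ⟨(norm_mode_le (hc0 i) h1 h2 hz).trans (h3 _),
    (norm_modeZ_le (hc0 i) h1 h2 hz).trans (h3 _),
    (norm_modeW_le (hc0 i) h1 h2 hz).trans (h3 _), (norm_modeZZ_le (hc0 i) h1 h2 hz).trans (h3 _),
    (norm_modeZW_le (hc0 i) h1 h2 hz).trans (h3 _), (norm_modeWW_le (hc0 i) h1 h2 hz).trans (h3 _)⟩

lemma hasFDerivAt_tsum_mode (hm : ∀ i, 6 ≤ m i) (hc0 : ∀ i, 0 ≤ c i) (hc : Summable c) (hD : 0 ≤ D)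
    (hh : ∀ i, Continuous (h i)) (hb : ∀ i, ∀ s ∈ Set.Icc (0 : ℝ) 1, |h i s| ≤ c i)
    (hbD : ∀ i, ∀ s ∈ Set.Icc (0 : ℝ) 1, |h i s| ≤ D * s)
    {z : ℂ} (hz : z ∈ ball (0 : ℂ) 1) :
    HasFDerivAt (fun w => ∑' i, mode (m i) (h i) w)
      (wirt (∑' i, modeZ (m i) (h i) z) (∑' i, modeW (m i) (h i) z)) z ∧
    HasFDerivAt (fun w => ∑' i, modeZ (m i) (h i) w)
      (wirt (∑' i, modeZZ (m i) (h i) z) (∑' i, modeZW (m i) (h i) z)) z ∧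
    HasFDerivAt (fun w => ∑' i, modeW (m i) (h i) w)
      (wirt (∑' i, modeZW (m i) (h i) z) (∑' i, modeWW (m i) (h i) z)) z := by
  have hl : ∀ {w : ℂ}, w ∈ ball (0 : ℂ) 1 → ‖w‖ ≤ 1 := fun hw => (mem_ball_zero_iff.1 hw).le
  have H : ∀ i, ∀ w ∈ ball (0 : ℂ) 1, _ := fun i w hw => norm_modes_le hm hc0 hb (hl hw) i
  refine ⟨hasFDerivAt_wirt_tsum (hc.mul_left 4)
      (fun i w => hasFDerivAt_wirt_mode hD (hm i) (hh i) (hbD i) w)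
      (fun i w hw => (H i w hw).1) (fun i w hw => (H i w hw).2.1)
      (fun i w hw => (H i w hw).2.2.1) hz,
    hasFDerivAt_wirt_tsum (hc.mul_left 4)
      (fun i w => hasFDerivAt_wirt_modeZ hD (hm i) (hh i) (hbD i) w)
      (fun i w hw => (H i w hw).2.1) (fun i w hw => (H i w hw).2.2.2.1)
      (fun i w hw => (H i w hw).2.2.2.2.1) hz,
    hasFDerivAt_wirt_tsum (hc.mul_left 4)
      (fun i w => hasFDerivAt_wirt_modeW hD (hm i) (hh i) (hbD i) w)
      (fun i w hw => (H i w hw).2.2.1) (fun i w hw => (H i w hw).2.2.2.2.1)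
      (fun i w hw => (H i w hw).2.2.2.2.2) hz⟩

lemma contDiffOn_tsum_mode (hm : ∀ i, 6 ≤ m i) (hc0 : ∀ i, 0 ≤ c i) (hc : Summable c) (hD : 0 ≤ D)
    (hh : ∀ i, Continuous (h i)) (hb : ∀ i, ∀ s ∈ Set.Icc (0 : ℝ) 1, |h i s| ≤ c i)
    (hbD : ∀ i, ∀ s ∈ Set.Icc (0 : ℝ) 1, |h i s| ≤ D * s) :
    ContDiffOn ℝ 2 (fun w => ∑' i, mode (m i) (h i) w) (ball (0 : ℂ) 1) := by
  have hl : ∀ {w : ℂ}, w ∈ ball (0 : ℂ) 1 → ‖w‖ ≤ 1 := fun hw => (mem_ball_zero_iff.1 hw).le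
  have H : ∀ i, ∀ w ∈ ball (0 : ℂ) 1, _ := fun i w hw => norm_modes_le hm hc0 hb (hl hw) i
  have hD' := fun z hz => hasFDerivAt_tsum_mode hm hc0 hc hD hh hb hbD (z := z) hz
  have hZZ : ContDiffOn ℝ (0 : ℕ) (fun w => ∑' i, modeZZ (m i) (h i) w) (ball (0 : ℂ) 1) :=
    contDiffOn_zero.2 (continuousOn_tsum
      (fun i => (continuous_modeZZ hD (hm i) (hh i) (hbD i)).continuousOn) (hc.mul_left 4)
      fun i w hw => (H i w hw).2.2.2.1)
  have hZW : ContDiffOn ℝ (0 : ℕ) (fun w => ∑' i, modeZW (m i) (h i) w) (ball (0 : ℂ) 1) :=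
    contDiffOn_zero.2 (continuousOn_tsum
      (fun i => (continuous_modeZW hD (hm i) (hh i) (hbD i)).continuousOn) (hc.mul_left 4)
      fun i w hw => (H i w hw).2.2.2.2.1)
  have hWW : ContDiffOn ℝ (0 : ℕ) (fun w => ∑' i, modeWW (m i) (h i) w) (ball (0 : ℂ) 1) :=
    contDiffOn_zero.2 (continuousOn_tsum
      (fun i => (continuous_modeWW hD (hm i) (hh i) (hbD i)).continuousOn) (hc.mul_left 4)
      fun i w hw => (H i w hw).2.2.2.2.2)
  have hZ := contDiffOn_of_hasFDerivAt_wirt isOpen_ball (fun z hz => (hD' z hz).2.1) hZZ hZW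
  have hW := contDiffOn_of_hasFDerivAt_wirt isOpen_ball (fun z hz => (hD' z hz).2.2) hZW hWW
  have h2 := contDiffOn_of_hasFDerivAt_wirt (n := 1) isOpen_ball (fun z hz => (hD' z hz).1)
    (by simpa using hZ) (by simpa using hW)
  exact h2.of_le (by norm_num [one_add_one_eq_two])

lemma continuousOn_tsum_mode (hm : ∀ i, 6 ≤ m i) (hc0 : ∀ i, 0 ≤ c i) (hc : Summable c) (hD : 0 ≤ D)
    (hh : ∀ i, Continuous (h i)) (hb : ∀ i, ∀ s ∈ Set.Icc (0 : ℝ) 1, |h i s| ≤ c i)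
    (hbD : ∀ i, ∀ s ∈ Set.Icc (0 : ℝ) 1, |h i s| ≤ D * s) :
    ContinuousOn (fun w => ∑' i, mode (m i) (h i) w) (closedBall (0 : ℂ) 1) :=
  continuousOn_tsum (fun i _ _ => (hasFDerivAt_wirt_mode hD (hm i) (hh i)
      (hbD i) _).continuousAt.continuousWithinAt) (hc.mul_left 4)
    fun i _ hw => (norm_modes_le hm hc0 hb (mem_closedBall_zero_iff.1 hw) i).1

end

lemma im_mode_polar (m : ℕ) (h : ℝ → ℝ) {s : ℝ} (hs : 0 ≤ s) (φ : ℝ) :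
    (mode m h (s * Complex.exp (φ * Complex.I))).im = radSol m h s * sin (m * φ) := by
  have h1 : ‖(s : ℂ) * Complex.exp (φ * Complex.I)‖ = s := by
    rw [norm_mul, Complex.norm_exp_ofReal_mul_I, Complex.norm_real, norm_of_nonneg hs, mul_one]
  rw [mode, h1, mul_pow, ← Complex.exp_nat_mul, ← mul_assoc (m : ℂ), ← mul_assoc,
    ← Complex.ofReal_pow, ← Complex.ofReal_mul, ← Complex.ofReal_natCast, ← Complex.ofReal_mul,
    Complex.im_ofReal_mul, Complex.exp_ofReal_mul_I_im, radSol, mul_comm (s ^ m)]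

lemma im_modeZW_polar (m : ℕ) (h : ℝ → ℝ) {s : ℝ} (hs : 0 < s) (φ : ℝ) :
    (modeZW m h (s * Complex.exp (φ * Complex.I))).im = -(h s * sin (m * φ)) / 4 := by
  have h1 : ‖(s : ℂ) * Complex.exp (φ * Complex.I)‖ = s := by
    rw [norm_mul, Complex.norm_exp_ofReal_mul_I, Complex.norm_real, norm_of_nonneg hs.le, mul_one]
  have h2 : (s : ℂ) ^ m ≠ 0 := by simp [hs.ne']
  have h3 : modeZW m h (s * Complex.exp (φ * Complex.I)) =
      ((-(h s) / 4 : ℝ) : ℂ) * Complex.exp ((m * φ : ℝ) * Complex.I) := by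
    rw [modeZW, h1, mul_pow, ← Complex.exp_nat_mul, ← mul_assoc (m : ℂ)]
    push_cast
    field_simp
  rw [h3, Complex.im_ofReal_mul, Complex.exp_ofReal_mul_I_im]
  ring

lemma mode_exp_mul {n : ℕ} (hn : n ≠ 0) (i : ℕ) (h : ℝ → ℝ) (z : ℂ) :
    mode (n * (2 * i + 1)) h (Complex.exp ((π / n : ℝ) * Complex.I) * z) =
      -mode (n * (2 * i + 1)) h z := by
  have h1 : Complex.exp ((π / n : ℝ) * Complex.I) ^ n = -1 := by
    rw [← Complex.exp_nat_mul, ← Complex.exp_pi_mul_I]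
    have : (n : ℂ) ≠ 0 := Nat.cast_ne_zero.2 hn
    congr 1
    push_cast
    field_simp
  rw [mode, mode, norm_mul, Complex.norm_exp_ofReal_mul_I, one_mul, mul_pow, pow_mul, h1,
    Odd.neg_one_pow ⟨i, rfl⟩]
  ring

theorem exists_antiperiodic_henonSol {α : ℝ} (hα : 0 ≤ α) {n : ℕ} (hn : 6 ≤ n) {p : ℝ}
    (hp : 1 < p) (hp2 : p ≤ 5 / 4) : ∃ u : E2 → ℝ, IsHenonSol α p u ∧
      (∃ x ∈ ball (0 : E2) 1, u x ≠ 0) ∧ ∀ x, u (rot2 (π / n) x) = -u x := by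
  obtain ⟨h, D, hD, hh, hb, hbD, hs, s, hs0, ψ, hne⟩ := exists_profile hα (by omega : 4 ≤ n) hp hp2
  have hm : ∀ i : ℕ, 6 ≤ n * (2 * i + 1) := fun i => hn.trans (Nat.le_mul_of_pos_right _ (by omega))
  have hc := (summable_succ_rpow hp).mul_left D
  have hc0 : ∀ i : ℕ, 0 ≤ D * ((i : ℝ) + 1) ^ (-p) := fun i => by positivity
  have hn0 : (n : ℝ) ≠ 0 := Nat.cast_ne_zero.2 (by omega)
  have hang : ∀ (i : ℕ) (φ : ℝ), ((n * (2 * i + 1) : ℕ) : ℝ) * φ = (2 * i + 1 : ℕ) * (n * φ) :=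
    fun i φ => by push_cast; ring
  have hball : ∀ {x : E2}, x ∈ ball (0 : E2) 1 → toC x ∈ ball (0 : ℂ) 1 := fun hx => by
    simpa [norm_toC] using hx
  have hpolar : ∀ x : E2, toC x = (‖x‖ : ℝ) * Complex.exp ((toC x).arg * Complex.I) := fun x => by
    rw [← norm_toC, Complex.norm_mul_exp_arg_mul_I]
  set u : E2 → ℝ := fun x => (∑' i, mode (n * (2 * i + 1)) (h i) (toC x)).im with hu
  have hval : ∀ (x : E2) (r φ : ℝ), r ∈ Set.Icc (0 : ℝ) 1 →
      toC x = r * Complex.exp (φ * Complex.I) →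
      u x = oddSeries (fun i => radSol (n * (2 * i + 1)) (h i) r) (n * φ) := fun x r φ hr hx => by
    have hx1 : ‖toC x‖ ≤ 1 := by
      rw [hx, norm_mul, Complex.norm_exp_ofReal_mul_I, Complex.norm_real, norm_of_nonneg hr.1,
        mul_one]
      exact hr.2
    rw [hu, oddSeries]
    dsimp only
    rw [Complex.im_tsum (Summable.of_norm_bounded (hc.mul_left 4)
      fun i => (norm_modes_le hm hc0 hb hx1 i).1)]
    refine tsum_congr fun i => ?_
    rw [hx, im_mode_polar _ _ hr.1, hang]
  refine ⟨u, ⟨?_, ?_, fun x hx => ?_, fun x hx => ?_⟩, ?_, fun x => ?_⟩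
  · exact Complex.imCLM.contDiff.comp_contDiffOn
      ((contDiffOn_tsum_mode hm hc0 hc hD hh hb hbD).comp toC.contDiff.contDiffOn fun x => hball)
  · exact Complex.continuous_im.comp_continuousOn
      ((continuousOn_tsum_mode hm hc0 hc hD hh hb hbD).comp toC.continuous.continuousOn
        fun x hx => by simpa [norm_toC] using hx)
  · have hd := fun z hz => hasFDerivAt_tsum_mode hm hc0 hc hD hh hb hbD (z := z) hz
    have hr : ‖x‖ ∈ Set.Icc (0 : ℝ) 1 := ⟨norm_nonneg x, (mem_ball_zero_iff.1 hx).le⟩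
    rw [hu, lap_im_comp_toC hx (fun z hz => (hd z hz).1) (hd _ (hball hx)).2.1
      (hd _ (hball hx)).2.2, ← hu]
    rcases eq_or_ne x 0 with rfl | hx0
    · have : u 0 = 0 := by
        rw [hu]
        dsimp only
        rw [map_zero, tsum_congr fun i => mode_zero (by linarith [hm i]), tsum_zero,
          Complex.zero_im]
      rw [this, map_zero, tsum_congr fun i => modeZW_zero (by linarith [hm i]), tsum_zero]
      simp
    · have hsum := hs ‖x‖ hr (n * (toC x).arg)
      rw [mul_assoc, ← signedPow, hval x ‖x‖ _ hr (hpolar x), ← hsum.tsum_eq,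
        Complex.im_tsum (Summable.of_norm_bounded (hc.mul_left 4)
          fun i => (norm_modes_le hm hc0 hb (by rw [norm_toC]; exact hr.2) i).2.2.2.2.1),
        ← tsum_mul_left, ← tsum_neg]
      refine tsum_congr fun i => ?_
      conv_lhs => rw [hpolar x]
      rw [im_modeZW_polar _ _ (norm_pos_iff.2 hx0), hang]
      ring
  · rw [hval x 1 _ (by simp) (by simpa [hx] using hpolar x)]
    simp [oddSeries, radSol_one]
  · obtain ⟨x, hx⟩ := exists_toC_eq (s * Complex.exp ((ψ / n : ℝ) * Complex.I))
    have hxs : ‖x‖ = s := by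
      rw [← norm_toC, hx, norm_mul, Complex.norm_exp_ofReal_mul_I, Complex.norm_real,
        norm_of_nonneg hs0.1, mul_one]
    have hs1 : s ≠ 1 := by
      rintro rfl
      exact hne (by simp [oddSeries, radSol_one])
    refine ⟨x, mem_ball_zero_iff.2 (hxs ▸ lt_of_le_of_ne hs0.2 hs1), ?_⟩
    rwa [hval x s _ hs0 hx, mul_div_cancel₀ _ hn0]
  · rw [hu]
    dsimp only
    rw [toC_rot2, tsum_congr fun i => mode_exp_mul (by omega) i (h i) (toC x), tsum_neg,
      Complex.neg_im]

lemma rot2_rot2 (θ φ : ℝ) (x : E2) : rot2 θ (rot2 φ x) = rot2 (θ + φ) x := by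
  ext i
  fin_cases i <;> simp [rot2, cos_add, sin_add] <;> ring

lemma norm_rot2 (θ : ℝ) (x : E2) : ‖rot2 θ x‖ = ‖x‖ := by
  rw [← norm_toC, toC_rot2, norm_mul, Complex.norm_exp_ofReal_mul_I, one_mul, norm_toC]

lemma rot2_zero (x : E2) : rot2 0 x = x := by
  ext i
  fin_cases i <;> simp [rot2]

lemma rot2_two_mul_invariant {u : E2 → ℝ} {θ : ℝ} (hu : ∀ x, u (rot2 θ x) = -u x) (j : ℕ) (x : E2) :
    u (rot2 ((2 * j : ℕ) * θ) x) = u x := by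
  induction j with
  | zero => simp [rot2_zero]
  | succ j ih =>
    rw [show ((2 * (j + 1) : ℕ) : ℝ) * θ = θ + (θ + (2 * j : ℕ) * θ) by push_cast; ring,
      ← rot2_rot2, ← rot2_rot2, hu, hu, neg_neg, ih]

/-- A function which is antiperiodic under the rotation by `2 j θ` does not agree on the disc, up
to sign and rotation, with a function which is antiperiodic under the rotation by `θ`. -/
lemma not_eq_rotation {u v : E2 → ℝ} {θ : ℝ} {j : ℕ} (hu : ∀ x, u (rot2 ((2 * j : ℕ) * θ) x) = -u x)
    (hv : ∀ x, v (rot2 θ x) = -v x) (hne : ∃ x ∈ ball (0 : E2) 1, u x ≠ 0) (φ ε : ℝ) :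
    ¬ ∀ x ∈ closedBall (0 : E2) 1, u x = ε * v (rot2 φ x) := fun h => by
  obtain ⟨x, hx, hx0⟩ := hne
  have h1 := h x (ball_subset_closedBall hx)
  have h2 := h (rot2 ((2 * j : ℕ) * θ) x) (by
    simpa [norm_rot2] using (mem_ball_zero_iff.1 hx).le)
  rw [hu, rot2_rot2, add_comm, ← rot2_rot2, rot2_two_mul_invariant hv] at h2
  exact hx0 (by linarith)

lemma not_eq_rotation_of_lt {u : ℕ → E2 → ℝ}
    (hu : ∀ i x, u i (rot2 (π / (6 * 2 ^ i : ℕ)) x) = -u i x)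
    (hne : ∀ i, ∃ x ∈ ball (0 : E2) 1, u i x ≠ 0) {i j : ℕ} (hij : i < j) (φ ε : ℝ) :
    ¬ ∀ x ∈ closedBall (0 : E2) 1, u i x = ε * u j (rot2 φ x) := by
  obtain ⟨k, rfl⟩ := Nat.exists_eq_add_of_lt hij
  refine not_eq_rotation (j := 2 ^ k) (fun x => ?_) (hu _) (hne i) φ ε
  rw [← hu i x]
  congr 2
  push_cast
  rw [pow_succ, pow_add]
  field_simp

/-- multiplicity of nonradial sign-changing solutions for `p` close to 1:
there are `⌈(2+α)β/2 − 1⌉` sign-changing nonradial solutions, pairwise distinct modulo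
rotations about the origin and sign. -/
theorem stmt_19 (α : ℝ) (hα : 0 ≤ α) (β : ℝ) (hβ : 0 < β)
    (z20 : ℝ) (hz20 : IsNthZero 0 2 z20) (hβz : IsNthZero β 1 z20) :
    ∃ pbar : ℝ, 1 < pbar ∧ ∀ p ∈ Set.Ioo (1 : ℝ) pbar,
      ∃ u : Fin ((⌈(2 + α) * β / 2 - 1⌉).toNat) → E2 → ℝ,
        (∀ i, IsHenonSol α p (u i)) ∧
        (∀ i, (∃ x ∈ ball (0 : E2) 1, 0 < u i x) ∧ (∃ x ∈ ball (0 : E2) 1, u i x < 0)) ∧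
        (∀ i, ¬ ∃ g : ℝ → ℝ, ∀ x ∈ closedBall (0 : E2) 1, u i x = g ‖x‖) ∧
        (∀ i j, i ≠ j → ∀ θ : ℝ, ∀ ε : ℝ, ε = 1 ∨ ε = -1 →
          ¬ ∀ x ∈ closedBall (0 : E2) 1, u i x = ε * u j (rot2 θ x)) := by
  refine ⟨5 / 4, by norm_num, fun p hp => ?_⟩
  have hex : ∀ i : ℕ, ∃ u : E2 → ℝ, IsHenonSol α p u ∧ (∃ x ∈ ball (0 : E2) 1, u x ≠ 0) ∧
      ∀ x, u (rot2 (π / (6 * 2 ^ i : ℕ)) x) = -u x := fun i =>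
    exists_antiperiodic_henonSol hα (Nat.le_mul_of_pos_right 6 (by positivity)) hp.1 hp.2.le
  choose u hsol hne hu using hex
  have hball : ∀ (θ : ℝ) {x : E2}, x ∈ ball (0 : E2) 1 → rot2 θ x ∈ ball (0 : E2) 1 :=
    fun θ x hx => by simpa [norm_rot2] using hx
  refine ⟨fun i => u i, fun i => hsol i, fun i => ?_, fun i => ?_, fun i j hij θ ε hε heq => ?_⟩
  · obtain ⟨x, hx, hx0⟩ := hne i
    rcases hx0.lt_or_gt with h | h
    · exact ⟨⟨_, hball _ hx, (neg_pos.2 h).trans_eq (hu i x).symm⟩, x, hx, h⟩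
    · exact ⟨⟨x, hx, h⟩, _, hball _ hx, (hu i x).trans_lt (neg_neg_iff_pos.2 h)⟩
  · rintro ⟨g, hg⟩
    obtain ⟨x, hx, hx0⟩ := hne i
    have h1 := hg x (ball_subset_closedBall hx)
    have h2 := hg _ (ball_subset_closedBall (hball (π / (6 * 2 ^ (i : ℕ) : ℕ)) hx))
    rw [norm_rot2, ← h1] at h2
    exact hx0 (by linarith [hu i x])
  · rcases lt_or_gt_of_ne (Fin.val_ne_of_ne hij) with h | h
    · exact not_eq_rotation_of_lt hu hne h θ ε heq
    · refine not_eq_rotation_of_lt hu hne h (-θ) ε fun x hx => ?_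
      beta_reduce at heq
      rw [heq (rot2 (-θ) x) (by simpa [norm_rot2] using hx), rot2_rot2, add_neg_cancel, rot2_zero]
      rcases hε with rfl | rfl <;> ring
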